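/- Let n ≥ 3 and let X ⊂ S^n be an (n−1)-dimensional Sierpiński space. Then there exists a topological embedding h : X → S^n (a continuous injection, hence a homeomorphism onto its image) such that for every connected component V of S^n \ h(X), the topological frontier of V is a flat (n−1)-sphere. -/

import Mathlib

open Metric Set Topology Filter MeasureTheory

noncomputable section

abbrev Euc (n : ℕ) : Type := EuclideanSpace ℝ (Fin n)

abbrev Sph (n : ℕ) : Set (Euc (n+1)) := Metric.sphere 0 1

/-- The subtype of `A` is an `n`-cell: homeomorphic to the cube `[0,1]^n`. -/
def IsCell (n : ℕ) {α : Type*} [TopologicalSpace α] (A : Set α) : Prop :=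
  Nonempty (↥A ≃ₜ (Fin n → ↥(Set.Icc (0:ℝ) 1)))

/-- The collection of connected components of a set `A`. -/
def compsOf {α : Type*} [TopologicalSpace α] (A : Set α) : Set (Set α) :=
  {V | ∃ x ∈ A, V = connectedComponentIn A x}

/-- The connected components of the complement `S^n \ X`. -/
def connComps (n : ℕ) (X : Set (Euc (n+1))) : Set (Set (Euc (n+1))) :=
  compsOf ((Sph n) \ X)

/-- `X ⊆ S^n` is an `(n-1)`-dimensional Sierpiński space. -/
structure IsSierpinski (n : ℕ) (X : Set (Euc (n+1))) : Prop where
  subset : X ⊆ Sph n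
  isCompact : IsCompact X
  isConnected : IsConnected X
  exists_enum : ∃ U : ℕ → Set (Euc (n+1)),
    Function.Injective U ∧
    (∀ i, U i ∈ connComps n X) ∧
    (∀ V ∈ connComps n X, ∃ i, V = U i) ∧
    (∀ i, IsCell n ((Sph n) \ U i)) ∧
    (∀ i j, i ≠ j → closure (U i) ∩ closure (U j) = ∅) ∧
    (Sph n) ⊆ closure (⋃ i, U i) ∧
    Filter.Tendsto (fun i => Metric.diam (U i)) Filter.atTop (nhds 0)

/-- `Σ ⊆ S^n` is a flat `(n-1)`-sphere: some self-homeomorphism of `S^n` maps it onto the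
equator `{x ∈ S^n : x_{n+1} = 0}`. -/
def IsFlatSphere (n : ℕ) (S : Set (Euc (n+1))) : Prop :=
  S ⊆ Sph n ∧ ∃ F : ↥(Sph n) ≃ₜ ↥(Sph n),
    F '' {x : ↥(Sph n) | (x : Euc (n+1)) ∈ S} =
      {x : ↥(Sph n) | (x : Euc (n+1)) (Fin.last n) = 0}

/-- The frontier of `A` taken inside the sphere `S^n`, as a subset of the ambient space. -/
def sphFrontier (n : ℕ) (A : Set (Euc (n+1))) : Set (Euc (n+1)) :=
  Subtype.val '' frontier {x : ↥(Sph n) | (x : Euc (n+1)) ∈ A}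

lemma det_one_add_pos {n : ℕ} (A : Euc n →L[ℝ] Euc n) (hA : ‖A‖ < 1) :
    0 < (1 + A).det := by
  have hne : ∀ s ∈ Icc (0:ℝ) 1, (1 + s • A).det ≠ 0 := by
    intro s hs
    have hinj : Function.Injective (1 + s • A : Euc n →L[ℝ] Euc n) := by
      rw [injective_iff_map_eq_zero]
      intro x hx
      by_contra hx0
      have hx' : x = -(s • A x) := by
        have : x + s • A x = 0 := by simpa using hx
        exact eq_neg_of_add_eq_zero_left this
      have h1 : ‖x‖ ≤ ‖A‖ * ‖x‖ := by
        calc ‖x‖ = ‖s • A x‖ := by conv_lhs => rw [hx', norm_neg]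
          _ = s * ‖A x‖ := by rw [norm_smul, Real.norm_of_nonneg hs.1]
          _ ≤ 1 * ‖A x‖ := by gcongr; exact hs.2
          _ ≤ ‖A‖ * ‖x‖ := by rw [one_mul]; exact A.le_opNorm x
      have := norm_pos_iff.mpr hx0
      nlinarith
    intro h0
    have h2 := LinearMap.bot_lt_ker_of_det_eq_zero (f := ((1 + s • A : Euc n →L[ℝ] Euc n) : Euc n →ₗ[ℝ] Euc n)) h0
    rw [LinearMap.ker_eq_bot.mpr hinj] at h2
    exact lt_irrefl _ h2
  have hcont : Continuous fun s : ℝ => (1 + s • A).det := by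
    apply ContinuousLinearMap.continuous_det.comp
    fun_prop
  by_contra hneg
  push Not at hneg
  have h0 : (1 + (0:ℝ) • A).det = 1 := by simp [ContinuousLinearMap.det]
  have := intermediate_value_Icc' (f := fun s : ℝ => (1 + s • A).det) zero_le_one hcont.continuousOn
  obtain ⟨s, hs, hs0⟩ := this (show (0:ℝ) ∈ _ from ⟨by simpa using hneg, by simp only [h0]; norm_num⟩)
  exact hne s hs hs0

/-- Interpolation identity for determinants. -/
lemma det_interp (n : ℕ) (v : ℕ → ℝ) (hv : Function.Injective v) :
    ∃ w : ℕ → ℝ, (∑ i ∈ Finset.range (n+1), w i = 1) ∧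
      ∀ A : Euc n →L[ℝ] Euc n, (1 + A).det = ∑ i ∈ Finset.range (n+1), w i * (1 + v i • A).det := by
  refine ⟨fun i => (Lagrange.basis (Finset.range (n+1)) v i).eval 1, ?_, ?_⟩
  · have := Lagrange.sum_basis (s := Finset.range (n+1)) (v := v) hv.injOn (by simp)
    have h2 := congrArg (Polynomial.eval 1) this
    simpa [Polynomial.eval_finsetSum] using h2
  · intro A
    let b := (EuclideanSpace.basisFun (Fin n) ℝ).toBasis
    let M := LinearMap.toMatrix b b (A : Euc n →ₗ[ℝ] Euc n)
    let q : Polynomial ℝ := (((Polynomial.X : Polynomial ℝ) • M.map Polynomial.C + (1 : Matrix (Fin n) (Fin n) ℝ).map Polynomial.C).det : Polynomial ℝ)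
    have hq : ∀ t : ℝ, q.eval t = (1 + t • A).det := by
      intro t
      have : (1 + t • A).det = (LinearMap.toMatrix b b ((1 + t • A : Euc n →L[ℝ] Euc n) : Euc n →ₗ[ℝ] Euc n)).det := by
        rw [LinearMap.det_toMatrix]
      rw [this]
      have h3 : (LinearMap.toMatrix b b ((1 + t • A : Euc n →L[ℝ] Euc n) : Euc n →ₗ[ℝ] Euc n)) = 1 + t • M := by
        have : ((1 + t • A : Euc n →L[ℝ] Euc n) : Euc n →ₗ[ℝ] Euc n) = LinearMap.id + t • (A : Euc n →ₗ[ℝ] Euc n) := rfl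
        rw [this, map_add, map_smul, LinearMap.toMatrix_id]
      rw [h3]
      have h4 : q.eval t = Polynomial.evalRingHom t q := rfl
      rw [h4, RingHom.map_det]
      congr 1
      ext i j
      by_cases hij : i = j
      · subst hij; simp; ring
      · simp [Matrix.one_apply_ne hij]
        ring
    have hd : q.degree < (Finset.range (n+1)).card := by
      have := Polynomial.natDegree_det_X_add_C_le M 1
      rw [Finset.card_range]
      refine Polynomial.degree_le_natDegree.trans_lt ?_
      have h : q.natDegree ≤ n := by rw [Fintype.card_fin] at this; exact this
      exact_mod_cast Nat.lt_succ_of_le h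
    have := Lagrange.eq_interpolate (f := q) (s := Finset.range (n+1)) (v := v) hv.injOn hd
    have h2 := congrArg (Polynomial.eval 1) this
    rw [hq, one_smul, Lagrange.interpolate_apply, Polynomial.eval_finsetSum] at h2
    rw [h2]
    refine Finset.sum_congr rfl fun i _ => ?_
    rw [Polynomial.eval_mul, Polynomial.eval_C, hq, mul_comm]

theorem no_C1_retraction {n : ℕ} (r : Euc n → Euc n) (O : Set (Euc n)) (hO : IsOpen O)
    (hBO : closedBall 0 1 ⊆ O) (hr : ContDiffOn ℝ 1 r O)
    (h1 : ∀ x ∈ closedBall (0 : Euc n) 1, ‖r x‖ = 1) (h2 : ∀ x : Euc n, ‖x‖ = 1 → r x = x) : False := by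
  have hstr : ∀ x ∈ closedBall (0 : Euc n) 1, HasStrictFDerivAt r (fderiv ℝ r x) x := fun x hx =>
    (hr.contDiffAt (hO.mem_nhds (hBO hx))).hasStrictFDerivAt one_ne_zero
  let G : Euc n → (Euc n →L[ℝ] Euc n) := fun x => fderiv ℝ r x - 1
  have hGc : ContinuousOn G (closedBall 0 1) :=
    ((hr.continuousOn_fderiv_of_isOpen hO le_rfl).mono hBO).sub continuousOn_const
  obtain ⟨C, hC⟩ := (isCompact_closedBall (0 : Euc n) 1).exists_bound_of_continuousOn hGc
  have hCpos : 0 < |C| + 1 := by positivity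
  have hC' : ∀ x ∈ closedBall (0 : Euc n) 1, ‖G x‖ ≤ |C| + 1 := fun x hx =>
    (hC x hx).trans ((le_abs_self C).trans (by linarith))
  set K := |C| + 1 with hK
  let H : ℝ → Euc n → Euc n := fun t x => x + t • (r x - x)
  have hHd : ∀ t, ∀ x ∈ closedBall (0 : Euc n) 1, HasStrictFDerivAt (H t) (1 + t • G x) x := by
    intro t x hx
    exact (hasStrictFDerivAt_id x).add (((hstr x hx).sub (hasStrictFDerivAt_id x)).const_smul t)
  have hlip : ∀ x ∈ closedBall (0 : Euc n) 1, ∀ y ∈ closedBall (0 : Euc n) 1,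
      ‖(r y - y) - (r x - x)‖ ≤ K * ‖y - x‖ := by
    intro x hx y hy
    exact (convex_closedBall (0 : Euc n) 1).norm_image_sub_le_of_norm_hasFDerivWithin_le
      (f := fun z => r z - z) (f' := G)
      (fun z hz => ((hstr z hz).hasFDerivAt.sub (hasFDerivAt_id z)).hasFDerivWithinAt) hC' hx hy
  have hvol : ∀ t, 0 ≤ t → t * K < 1 →
      ∫ x in ball (0 : Euc n) 1, (1 + t • G x).det = (volume (ball (0 : Euc n) 1)).toReal := by
    intro t ht htK
    have ht1 : t < 1 := by nlinarith [abs_nonneg C]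
    have hpos : ∀ x ∈ closedBall (0 : Euc n) 1, 0 < (1 + t • G x).det := by
      intro x hx
      apply det_one_add_pos
      rw [norm_smul, Real.norm_of_nonneg ht]
      exact lt_of_le_of_lt (mul_le_mul_of_nonneg_left (hC' x hx) ht) htK
    have hinj : InjOn (H t) (closedBall 0 1) := by
      intro x hx y hy hxy
      by_contra hne
      have h3 : y - x = -(t • ((r y - y) - (r x - x))) := by
        have : x + t • (r x - x) = y + t • (r y - y) := hxy
        rw [smul_sub, neg_sub, ← sub_eq_zero]
        rw [← sub_eq_zero] at this
        rw [← neg_eq_zero, ← this]; abel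
      have h4 : ‖y - x‖ ≤ t * (K * ‖y - x‖) := by
        conv_lhs => rw [h3, norm_neg, norm_smul, Real.norm_of_nonneg ht]
        exact mul_le_mul_of_nonneg_left (hlip x hx y hy) ht
      have : 0 < ‖y - x‖ := norm_pos_iff.mpr (sub_ne_zero.mpr (Ne.symm hne))
      nlinarith
    have hmaps : MapsTo (H t) (ball 0 1) (ball 0 1) := by
      intro x hx
      rw [mem_ball_zero_iff] at hx ⊢
      have h5 : H t x = (1 - t) • x + t • r x := by simp only [H]; module
      rw [h5]
      refine (norm_add_le _ _).trans_lt ?_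
      rw [norm_smul, norm_smul, Real.norm_of_nonneg ht, Real.norm_of_nonneg (by linarith),
        h1 x (mem_closedBall_zero_iff.mpr hx.le)]
      nlinarith
    have hHc : ContinuousOn (H t) (closedBall 0 1) := fun x hx =>
      (hHd t x hx).hasFDerivAt.continuousAt.continuousWithinAt
    have himg : H t '' ball 0 1 = ball 0 1 := by
      have hop : IsOpen (H t '' ball 0 1) := by
        rw [isOpen_iff_mem_nhds]
        rintro _ ⟨x, hx, rfl⟩
        have hx' := ball_subset_closedBall hx
        have hs := hHd t x hx'
        rw [← ContinuousLinearMap.coe_toContinuousLinearEquivOfDetNeZero _ (hpos x hx').ne'] at hs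
        rw [← hs.map_nhds_eq_of_equiv]
        exact image_mem_map (isOpen_ball.mem_nhds hx)
      have hcl : IsClosed (H t '' closedBall 0 1) := ((isCompact_closedBall 0 1).image_of_continuousOn hHc).isClosed
      refine Subset.antisymm hmaps.image_subset ?_
      apply (convex_ball (0 : Euc n) 1).isPreconnected.subset_of_closure_inter_subset hop
      · exact ⟨H t 0, hmaps (by simp), mem_image_of_mem _ (by simp)⟩
      · rintro y ⟨hy, hyb⟩
        have := closure_minimal (image_mono ball_subset_closedBall) hcl hy
        obtain ⟨x, hx, rfl⟩ := this
        refine mem_image_of_mem _ ?_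
        rw [mem_closedBall_zero_iff] at hx
        rcases hx.lt_or_eq with h | h
        · simpa using h
        · exfalso
          have : H t x = x := by simp [H, h2 x h]
          rw [this] at hyb
          simp [h] at hyb
    have hcv := lintegral_abs_det_fderiv_eq_addHaar_image (volume : Measure (Euc n)) measurableSet_ball
      (fun x hx => (hHd t x (ball_subset_closedBall hx)).hasFDerivAt.hasFDerivWithinAt)
      (hinj.mono ball_subset_closedBall)
    rw [himg] at hcv
    rw [← hcv, integral_eq_lintegral_of_nonneg_ae]
    · congr 1
      refine setLIntegral_congr_fun measurableSet_ball fun x hx => ?_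
      rw [abs_of_pos (hpos x (ball_subset_closedBall hx))]
    · exact (ae_restrict_iff' measurableSet_ball).mpr (Eventually.of_forall fun x hx =>
        (hpos x (ball_subset_closedBall hx)).le)
    · apply ContinuousOn.aestronglyMeasurable _ measurableSet_ball
      apply ContinuousLinearMap.continuous_det.comp_continuousOn
      exact continuousOn_const.add ((hGc.mono ball_subset_closedBall).const_smul t)
  obtain ⟨w, hw1, hw2⟩ := det_interp n (fun i : ℕ => 1 / (K * (i + 2))) (by
    intro i j hij
    have hij : 1 / (K * ((i:ℝ) + 2)) = 1 / (K * (j + 2)) := hij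
    field_simp at hij
    have : (i:ℝ) = j := by linarith
    exact_mod_cast this)
  have hzero : ∀ x ∈ ball (0 : Euc n) 1, (1 + G x).det = 0 := by
    intro x hx
    have hG : 1 + G x = fderiv ℝ r x := by simp [G]
    rw [hG]
    by_contra hne
    have hx' := ball_subset_closedBall hx
    have hs := hstr x hx'
    rw [← ContinuousLinearMap.coe_toContinuousLinearEquivOfDetNeZero _ hne] at hs
    have h6 : r '' ball 0 1 ∈ 𝓝 (r x) := by
      rw [← hs.map_nhds_eq_of_equiv]
      exact image_mem_map (isOpen_ball.mem_nhds hx)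
    have h7 : r '' ball 0 1 ⊆ sphere 0 1 := by
      rintro _ ⟨y, hy, rfl⟩
      simpa using h1 y (ball_subset_closedBall hy)
    have h8 : r x ∈ interior (sphere (0 : Euc n) 1) := mem_interior_iff_mem_nhds.mpr (mem_of_superset h6 h7)
    rw [interior_sphere _ one_ne_zero] at h8
    exact h8
  have hintg : ∀ t : ℝ, IntegrableOn (fun x => (1 + t • G x).det) (ball (0 : Euc n) 1) := by
    intro t
    refine IntegrableOn.mono_set (ContinuousOn.integrableOn_compact (isCompact_closedBall 0 1) ?_) ball_subset_closedBall
    apply ContinuousLinearMap.continuous_det.comp_continuousOn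
    exact continuousOn_const.add (hGc.const_smul t)
  have e1 : ∫ x in ball (0 : Euc n) 1, (1 + G x).det = 0 := by
    rw [setIntegral_congr_fun measurableSet_ball hzero]; simp
  have e2 : ∫ x in ball (0 : Euc n) 1, (1 + G x).det = (volume (ball (0 : Euc n) 1)).toReal := by
    rw [integral_congr_ae (Eventually.of_forall fun x => hw2 (G x))]
    rw [integral_finsetSum _ (fun i _ => (hintg _).const_mul _)]
    simp_rw [integral_const_mul]
    calc _ = ∑ i ∈ Finset.range (n+1), w i * (volume (ball (0 : Euc n) 1)).toReal := by
          refine Finset.sum_congr rfl fun i _ => ?_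
          rw [hvol _ (by positivity)]
          field_simp
          linarith [show (0:ℝ) ≤ i from Nat.cast_nonneg i]
      _ = _ := by rw [← Finset.sum_mul, hw1, one_mul]
  rw [e1] at e2
  have := ENNReal.toReal_pos (measure_ball_pos volume (0 : Euc n) one_pos).ne' measure_ball_lt_top.ne
  linarith

theorem brouwer_C1 {n : ℕ} (p : Euc n → Euc n) (hp : ContDiff ℝ 1 p)
    (hB : ∀ x ∈ closedBall (0 : Euc n) 1, ‖p x‖ ≤ 1) : ∃ x ∈ closedBall (0 : Euc n) 1, p x = x := by
  by_contra! hne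
  let w : Euc n → Euc n := fun x => x - p x
  let D : Euc n → ℝ := fun x => (inner ℝ x (w x))^2 + ‖w x‖^2 * (1 - ‖x‖^2)
  let t : Euc n → ℝ := fun x => (- inner ℝ x (w x) + Real.sqrt (D x)) / ‖w x‖^2
  have hwc : ContDiff ℝ 1 w := contDiff_id.sub hp
  have hDc : ContDiff ℝ 1 D := by
    have h1 : ContDiff ℝ 1 (fun x : Euc n => ‖w x‖^2) := hwc.norm_sq ℝ
    have h2 : ContDiff ℝ 1 (fun x : Euc n => ‖x‖^2) := contDiff_id.norm_sq ℝ
    exact ((contDiff_id.inner ℝ hwc).pow 2).add (h1.mul (contDiff_const.sub h2))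
  let O : Set (Euc n) := {x | w x ≠ 0 ∧ 0 < D x}
  have hO : IsOpen O := (isOpen_ne_fun hwc.continuous continuous_const).inter
    (isOpen_lt continuous_const hDc.continuous)
  have hw0 : ∀ x ∈ closedBall (0 : Euc n) 1, w x ≠ 0 := fun x hx => sub_ne_zero.mpr (hne x hx).symm
  have hbd : ∀ x : Euc n, ‖x‖ = 1 → 0 < inner ℝ x (w x) := by
    intro x hx
    have hxB : x ∈ closedBall (0 : Euc n) 1 := by simp [hx]
    have h1 : inner ℝ x (w x) = 1 - inner ℝ x (p x) := by
      simp only [w]; rw [inner_sub_right, real_inner_self_eq_norm_sq, hx]; norm_num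
    have h2 : ‖w x‖^2 = ‖x‖^2 - 2 * inner ℝ x (p x) + ‖p x‖^2 := norm_sub_sq_real x (p x)
    have h3 : 0 < ‖w x‖^2 := by have := norm_pos_iff.mpr (hw0 x hxB); positivity
    have h4 := hB x hxB
    have h5 : ‖p x‖^2 ≤ 1 := by nlinarith [norm_nonneg (p x)]
    rw [h1]; rw [hx] at h2; linarith
  have hBO : closedBall (0 : Euc n) 1 ⊆ O := by
    intro x hx
    refine ⟨hw0 x hx, ?_⟩
    have hwp := norm_pos_iff.mpr (hw0 x hx)
    rw [mem_closedBall_zero_iff] at hx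
    rcases hx.lt_or_eq with h | h
    · have : 0 < 1 - ‖x‖^2 := by nlinarith [norm_nonneg x]
      have := mul_pos (pow_pos hwp 2) this
      simp only [D]; positivity
    · have := hbd x h
      simp only [D, h]; norm_num; positivity
  have htc : ContDiffOn ℝ 1 t O := by
    apply ContDiffOn.div
    · exact ((contDiff_id.inner ℝ hwc).neg.contDiffOn).add (hDc.contDiffOn.sqrt fun x hx => hx.2.ne')
    · exact (hwc.norm_sq ℝ).contDiffOn
    · intro x hx; exact pow_ne_zero 2 (norm_ne_zero_iff.mpr hx.1)
  refine no_C1_retraction (fun x => x + t x • w x) O hO hBO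
    (contDiffOn_id.add (htc.smul hwc.contDiffOn)) ?_ ?_
  · intro x hx
    have hwp := norm_pos_iff.mpr (hw0 x hx)
    have h1 : ‖x + t x • w x‖^2 = 1 := by
      rw [norm_add_sq_real, norm_smul, real_inner_smul_right, Real.norm_eq_abs, mul_pow, sq_abs]
      have h2 : t x * ‖w x‖^2 = - inner ℝ x (w x) + Real.sqrt (D x) := by
        simp only [t]; field_simp
      have h3 : Real.sqrt (D x)^2 = D x := Real.sq_sqrt (hBO hx).2.le
      have h4 : (t x * ‖w x‖^2 + inner ℝ x (w x))^2 = D x := by rw [h2, neg_add_eq_sub, sub_add_cancel, h3]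
      simp only [D] at h4
      have h5 : ‖w x‖^2 * (‖x‖^2 + 2 * (t x * inner ℝ x (w x)) + t x ^2 * ‖w x‖^2) = ‖w x‖^2 * 1 := by
        nlinarith
      exact mul_left_cancel₀ (by positivity) h5
    nlinarith [norm_nonneg (x + t x • w x)]
  · intro x hx
    have : t x = 0 := by
      simp only [t, D, hx]
      norm_num
      rw [Real.sqrt_sq (hbd x hx).le]; simp
    simp [this]

lemma tietze_euc {α : Type*} [TopologicalSpace α] [NormalSpace α] {n : ℕ} {K : Set α}
    {f : α → Euc n} (hK : IsClosed K) (hf : ContinuousOn f K) :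
    ∃ g : α → Euc n, Continuous g ∧ ∀ x ∈ K, g x = f x := by
  obtain ⟨g, hg⟩ := ContinuousMap.exists_restrict_eq hK
    (⟨fun x : K => f x, continuousOn_iff_continuous_domRestrict.mp hf⟩ : C(K, Euc n))
  refine ⟨g, g.continuous, fun x hx => ?_⟩
  exact congrArg (fun φ : C(K, Euc n) => φ ⟨x, hx⟩) hg

theorem brouwer {n : ℕ} (f : Euc n → Euc n) (hf : ContinuousOn f (closedBall 0 1))
    (hB : ∀ x ∈ closedBall (0 : Euc n) 1, ‖f x‖ ≤ 1) : ∃ x ∈ closedBall (0 : Euc n) 1, f x = x := by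
  by_contra! hne
  obtain ⟨x0, hx0, hmin⟩ := (isCompact_closedBall (0 : Euc n) 1).exists_isMinOn ⟨0, by simp⟩
    (f := fun x => ‖f x - x‖) (hf.sub continuousOn_id).norm
  set δ := ‖f x0 - x0‖ with hδ
  have hδp : 0 < δ := norm_pos_iff.mpr (sub_ne_zero.mpr (hne x0 hx0))
  obtain ⟨g, hgc, hgf⟩ := tietze_euc isClosed_closedBall hf
  obtain ⟨q, hq, hqg, -⟩ := hgc.exists_contDiff_approx 1 (ε := fun _ => δ / 4)
    continuous_const (fun _ => by positivity)
  have hqf : ∀ x ∈ closedBall (0 : Euc n) 1, ‖q x - f x‖ < δ / 4 := fun x hx => by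
    have := hqg x
    rwa [hgf x hx, dist_eq_norm] at this
  obtain ⟨x, hx, hxe⟩ := brouwer_C1 (fun x => (1 + δ/4)⁻¹ • q x) (hq.const_smul _) (by
    intro x hx
    rw [norm_smul, norm_inv, Real.norm_of_nonneg (by positivity), inv_mul_le_one₀ (by positivity)]
    have h1 := hqf x hx
    have h2 := hB x hx
    have h3 : q x = f x + (q x - f x) := by abel
    rw [h3]
    exact (norm_add_le _ _).trans (by linarith))
  have h1 : q x = (1 + δ/4) • x := by
    conv_rhs => rw [← hxe, smul_smul, mul_inv_cancel₀ (by positivity), one_smul]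
  have h2 : f x - x = (δ/4) • x - (q x - f x) := by rw [h1]; module
  have h3 : ‖f x - x‖ ≤ δ/4 * ‖x‖ + δ/4 := by
    rw [h2]
    refine (norm_sub_le _ _).trans ?_
    rw [norm_smul, Real.norm_of_nonneg (by positivity)]
    linarith [hqf x hx]
  have h4 : δ ≤ ‖f x - x‖ := hmin hx
  rw [mem_closedBall_zero_iff] at hx
  nlinarith

lemma contOn_inv_of_compact {α β : Type*} [TopologicalSpace α] [TopologicalSpace β] [T2Space β]
    {K : Set α} (hK : IsCompact K) {f : α → β} (hf : ContinuousOn f K) (g : β → α)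
    (hg : ∀ x ∈ K, g (f x) = x) : ContinuousOn g (f '' K) := by
  rw [continuousOn_iff_isClosed]
  intro t ht
  refine ⟨f '' (K ∩ t), ((hK.inter_right ht).image_of_continuousOn (hf.mono inter_subset_left)).isClosed, ?_⟩
  ext y
  constructor
  · rintro ⟨hy, x, hx, rfl⟩
    have : x ∈ t := by have h := hy; rw [mem_preimage, hg x hx] at h; exact h
    exact ⟨⟨x, ⟨hx, this⟩, rfl⟩, ⟨x, hx, rfl⟩⟩
  · rintro ⟨⟨x, ⟨hx, hxt⟩, rfl⟩, -⟩
    refine ⟨?_, ⟨x, hx, rfl⟩⟩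
    rw [mem_preimage, hg x hx]; exact hxt

theorem inv_dom_ball {n : ℕ} (f : Euc n → Euc n) (hf : ContinuousOn f (closedBall 0 1))
    (hinj : InjOn f (closedBall 0 1)) : f '' closedBall 0 1 ∈ 𝓝 (f 0) := by
  set K := f '' closedBall 0 1 with hKdef
  have hKc : IsCompact K := (isCompact_closedBall 0 1).image_of_continuousOn hf
  have hG0 := contOn_inv_of_compact (isCompact_closedBall 0 1) hf (Function.invFunOn f (closedBall 0 1))
    (fun x hx => hinj.leftInvOn_invFunOn hx)
  obtain ⟨G, hGc, hGK⟩ := tietze_euc hKc.isClosed hG0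
  have hGf : ∀ x ∈ closedBall (0 : Euc n) 1, G (f x) = x := fun x hx => by
    rw [hGK _ (mem_image_of_mem f hx)]; exact hinj.leftInvOn_invFunOn hx
  have h00 : (0 : Euc n) ∈ closedBall (0 : Euc n) 1 := by simp
  by_contra hnot
  obtain ⟨ε', hε', hεG⟩ : ∃ ε' > 0, ∀ y, dist y (f 0) < ε' → ‖G y‖ < 1/10 := by
    have := Metric.continuousAt_iff.mp (hGc.continuousAt (x := f 0)) (1/10) (by norm_num)
    obtain ⟨ε', h1, h2⟩ := this
    refine ⟨ε', h1, fun y hy => ?_⟩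
    have := h2 hy
    rwa [hGf 0 h00, dist_zero_right] at this
  obtain ⟨ε, hε, hε2⟩ : ∃ ε > 0, 2 * ε < ε' := ⟨ε'/4, by positivity, by linarith⟩
  obtain ⟨c, hc, hcK⟩ : ∃ c, dist c (f 0) < ε ∧ c ∉ K := by
    by_contra! h
    exact hnot (mem_of_superset (ball_mem_nhds _ hε) fun y hy => h y hy)
  have hcy : ∀ y ∈ K, 0 < ‖y - c‖ := fun y hy => norm_pos_iff.mpr (sub_ne_zero.mpr fun h => hcK (h ▸ hy))
  obtain ⟨δ, hδ, hδG⟩ : ∃ δ > 0, ∀ y ∈ K, ε ≤ ‖y - c‖ → δ ≤ ‖G y‖ := by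
    have hS : IsCompact (K ∩ {y | ε ≤ ‖y - c‖}) :=
      hKc.inter_right (isClosed_le continuous_const (by fun_prop))
    rcases (K ∩ {y | ε ≤ ‖y - c‖}).eq_empty_or_nonempty with he | hne
    · exact ⟨1, one_pos, fun y hy h => absurd (show y ∈ (∅ : Set (Euc n)) from he ▸ ⟨hy, h⟩) (by simp)⟩
    · obtain ⟨y0, hy0, hmin⟩ := hS.exists_isMinOn hne (f := fun y => ‖G y‖) hGc.norm.continuousOn
      refine ⟨‖G y0‖, ?_, fun y hy h => hmin ⟨hy, h⟩⟩
      obtain ⟨⟨x, hx, rfl⟩, hy⟩ := hy0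
      rw [hGf x hx]
      apply norm_pos_iff.mpr
      rintro rfl
      rw [dist_comm, dist_eq_norm] at hc
      exact absurd hy (not_le.mpr hc)
  set η := min (δ/2) (1/20) with hη
  have hηp : 0 < η := lt_min (by positivity) (by norm_num)
  obtain ⟨P, hP, hPG, -⟩ := hGc.exists_contDiff_approx 1 (ε := fun _ => η) continuous_const (fun _ => hηp)
  have hnull : volume (P '' sphere c ε) = 0 :=
    addHaar_image_eq_zero_of_differentiableOn_of_addHaar_eq_zero volume
      (hP.differentiable (by simp)).differentiableOn (Measure.addHaar_sphere_of_ne_zero _ _ hε.ne')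
  obtain ⟨a, ha, haP⟩ : ∃ a ∈ ball (0 : Euc n) η, a ∉ P '' sphere c ε := by
    by_contra! h
    have := measure_mono_null h hnull
    exact (measure_ball_pos volume (0 : Euc n) hηp).ne' this
  rw [mem_ball_zero_iff] at ha
  have hη1 : η ≤ δ/2 := min_le_left _ _
  have hη2 : η ≤ 1/20 := min_le_right _ _
  let Q : Euc n → Euc n := fun y => P y - a
  have hQG : ∀ y, ‖Q y - G y‖ < 2 * η := by
    intro y
    have h1 := hPG y
    rw [dist_eq_norm] at h1
    have : Q y - G y = (P y - G y) - a := by simp only [Q]; abel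
    rw [this]
    exact (norm_sub_le _ _).trans_lt (by linarith)
  let Φ : Euc n → Euc n := fun y => c + (max (ε / ‖y - c‖) 1) • (y - c)
  have hΦ1 : ∀ y ∈ K, ε ≤ ‖y - c‖ → Φ y = y := by
    intro y hy h
    have : ε / ‖y - c‖ ≤ 1 := (div_le_one (hcy y hy)).mpr h
    simp [Φ, max_eq_right this]
  have hΦ2 : ∀ y ∈ K, ‖y - c‖ < ε → ‖Φ y - c‖ = ε := by
    intro y hy h
    have h1 := hcy y hy
    have : 1 ≤ ε / ‖y - c‖ := (one_le_div h1).mpr h.le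
    simp only [Φ, max_eq_left this, add_sub_cancel_left]
    rw [norm_smul, Real.norm_of_nonneg (by positivity)]
    field_simp
  have hΦc : ContinuousOn Φ K := by
    have hn : ContinuousOn (fun y : Euc n => y - c) K := by fun_prop
    have h1 : ContinuousOn (fun y : Euc n => ε / ‖y - c‖) K :=
      continuousOn_const.div hn.norm fun y hy => (hcy y hy).ne'
    have h2 : ContinuousOn (fun y : Euc n => max (ε / ‖y - c‖) 1) K := h1.sup continuousOn_const
    exact continuousOn_const.add (h2.smul hn)
  have hne : ∀ y ∈ K, Q (Φ y) ≠ 0 := by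
    intro y hy h0
    rcases le_or_gt ε ‖y - c‖ with h | h
    · rw [hΦ1 y hy h] at h0
      have h1 := hQG y
      rw [h0, zero_sub, norm_neg] at h1
      linarith [hδG y hy h]
    · apply haP
      exact ⟨Φ y, by simpa [dist_eq_norm] using hΦ2 y hy h, sub_eq_zero.mp h0⟩
  have hclose : ∀ y ∈ K, ‖G y - Q (Φ y)‖ ≤ 1 := by
    intro y hy
    rcases le_or_gt ε ‖y - c‖ with h | h
    · rw [hΦ1 y hy h, norm_sub_rev]
      linarith [hQG y]
    · have h1 : ‖G y‖ < 1/10 := by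
        apply hεG
        have := dist_triangle y c (f 0)
        rw [dist_eq_norm y c] at this
        linarith
      have h2 : ‖G (Φ y)‖ < 1/10 := by
        apply hεG
        have := dist_triangle (Φ y) c (f 0)
        rw [dist_eq_norm (Φ y) c, hΦ2 y hy h] at this
        linarith
      have h3 := hQG (Φ y)
      have h4 : G y - Q (Φ y) = G y - (Q (Φ y) - G (Φ y)) - G (Φ y) := by abel
      rw [h4]
      refine (norm_sub_le _ _).trans ?_
      have := norm_sub_le (G y) (Q (Φ y) - G (Φ y))
      linarith
  obtain ⟨x, hx, hxe⟩ := brouwer (fun x => x - Q (Φ (f x))) (by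
      have h1 : Continuous Q := hP.continuous.sub continuous_const
      exact continuousOn_id.sub (h1.comp_continuousOn (hΦc.comp hf (mapsTo_image f _)))) (by
      intro x hx
      have := hclose (f x) (mem_image_of_mem f hx)
      rwa [hGf x hx] at this)
  exact hne (f x) (mem_image_of_mem f hx) (by simpa using hxe)

/-- Invariance of domain. -/
theorem inv_dom {n : ℕ} (f : Euc n → Euc n) (O : Set (Euc n)) (hO : IsOpen O) (hf : ContinuousOn f O)
    (hinj : InjOn f O) : IsOpen (f '' O) := by
  rw [isOpen_iff_mem_nhds]
  rintro _ ⟨x, hx, rfl⟩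
  obtain ⟨ε, hε, hb⟩ := Metric.nhds_basis_closedBall.mem_iff.mp (hO.mem_nhds hx)
  have hmem : ∀ z ∈ closedBall (0 : Euc n) 1, x + ε • z ∈ closedBall x ε := by
    intro z hz
    rw [mem_closedBall_zero_iff] at hz
    rw [mem_closedBall, dist_eq_norm, add_sub_cancel_left, norm_smul, Real.norm_of_nonneg hε.le]
    nlinarith
  have := inv_dom_ball (fun z => f (x + ε • z))
    (hf.comp (by fun_prop) fun z hz => hb (hmem z hz))
    (by
      intro z hz w hw h
      have h2 := hinj (hb (hmem z hz)) (hb (hmem w hw)) h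
      exact smul_right_injective _ hε.ne' (add_left_cancel h2))
  simp only [smul_zero, add_zero] at this
  refine mem_of_superset this ?_
  rintro _ ⟨z, hz, rfl⟩
  exact mem_image_of_mem f (hb (hmem z hz))

lemma stretch_iso (c d w : ℝ) (hd : 0 < d) (hw : 0 < w) : ∃ s : ℝ ≃o ℝ,
    (∀ t ≤ c, s t = t) ∧ s (c + d) = c + w ∧ ∀ t, c + d ≤ t → s t = t - d + w := by
  let s : ℝ → ℝ := fun t => min t c + (w / d) * (min (max (t - c) 0) d) + max (t - c - d) 0
  have hwd : 0 < w / d := by positivity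
  have h1 : ∀ t ≤ c, s t = t := by
    intro t ht
    simp only [s]
    rw [min_eq_left ht, max_eq_right (by linarith : t - c ≤ 0), min_eq_left hd.le,
      max_eq_right (by linarith)]; ring
  have h2 : ∀ t, c ≤ t → t ≤ c + d → s t = c + w / d * (t - c) := by
    intro t ht ht2
    simp only [s]
    rw [min_eq_right ht, max_eq_left (by linarith : 0 ≤ t - c), min_eq_left (by linarith),
      max_eq_right (by linarith)]; ring
  have h3 : ∀ t, c + d ≤ t → s t = t - d + w := by
    intro t ht
    simp only [s]
    rw [min_eq_right (by linarith), max_eq_left (by linarith : 0 ≤ t - c),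
      min_eq_right (by linarith), max_eq_left (by linarith)]; field_simp; ring
  have hwd' : w / d * d = w := by field_simp
  have hmono : StrictMono s := by
    intro t t' htt
    have ha : min t c ≤ min t' c := min_le_min_right _ htt.le
    have hb : (w / d) * (min (max (t - c) 0) d) ≤ (w / d) * (min (max (t' - c) 0) d) := by gcongr
    have hc : max (t - c - d) 0 ≤ max (t' - c - d) 0 := by gcongr
    rcases lt_or_ge t c with h | h
    · have : min t c < min t' c := by
        rw [min_eq_left h.le]; exact lt_min htt h
      simp only [s]; linarith
    rcases lt_or_ge t (c + d) with h' | h'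
    · have : (w / d) * (min (max (t - c) 0) d) < (w / d) * (min (max (t' - c) 0) d) := by
        apply mul_lt_mul_of_pos_left _ hwd
        rw [max_eq_left (by linarith), max_eq_left (by linarith : 0 ≤ t' - c),
          min_eq_left (by linarith)]
        exact lt_min (by linarith) (by linarith)
      simp only [s]; linarith
    · rw [h3 t h', h3 t' (by linarith)]; linarith
  have hsurj : Function.Surjective s := by
    intro y
    rcases le_or_gt y c with h | h
    · exact ⟨y, h1 y h⟩
    rcases le_or_gt y (c + w) with h' | h'
    · have h5 : 0 ≤ d / w * (y - c) := mul_nonneg (by positivity) (by linarith)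
      have h6 : d / w * (y - c) ≤ d := by
        rw [div_mul_eq_mul_div, div_le_iff₀ hw]; gcongr; linarith
      refine ⟨c + d / w * (y - c), ?_⟩
      rw [h2 _ (by linarith) (by linarith)]; field_simp; ring
    · exact ⟨y - w + d, by rw [h3 _ (by linarith)]; ring⟩
  refine ⟨hmono.orderIsoOfSurjective s hsurj, h1, ?_, h3⟩
  show s (c + d) = c + w
  rw [h3 _ le_rfl]; ring

lemma pl_iso (k w : ℕ → ℝ) (m : ℕ) (hk : ∀ i < m, k i < k (i+1)) (hw : ∀ i < m, 0 < w i) :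
    ∃ g : ℝ ≃o ℝ, (∀ t ≤ k 0, g t = t) ∧ (∀ j ≤ m, g (k j) = k 0 + ∑ i ∈ Finset.range j, w i) ∧
      ∀ t, k m ≤ t → g t = g (k m) + (t - k m) := by
  induction m with
  | zero =>
    refine ⟨OrderIso.refl _, fun t _ => rfl, ?_, fun t _ => by simp⟩
    intro j hj
    obtain rfl : j = 0 := by omega
    simp
  | succ m ih =>
    obtain ⟨g, g1, g2, g3⟩ := ih (fun i hi => hk i (by omega)) (fun i hi => hw i (by omega))
    obtain ⟨s, s1, s2, s3⟩ := stretch_iso (g (k m)) (k (m+1) - k m) (w m)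
      (sub_pos.2 (hk m (by omega))) (hw m (by omega))
    have hkm := hk m (by omega)
    have hmono : ∀ j ≤ m, k j ≤ k m := by
      intro j hj
      have : ∀ i, j ≤ i → i ≤ m → k j ≤ k i := by
        intro i hi
        induction i, hi using Nat.le_induction with
        | base => intro _; exact le_rfl
        | succ i hi ih2 => intro h; exact (ih2 (by omega)).trans (hk i (by omega)).le
      exact this m hj le_rfl
    have g4 := g3 (k (m+1)) hkm.le
    have e1 : s (g (k (m+1))) = g (k m) + w m := by
      rw [g4]; exact s2
    refine ⟨g.trans s, ?_, ?_, ?_⟩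
    · intro t ht
      show s (g t) = t
      rw [s1 _ (g.monotone (ht.trans (hmono 0 (by omega)))), g1 t ht]
    · intro j hj
      show s (g (k j)) = _
      rcases Nat.lt_or_ge m j with h | h
      · obtain rfl : j = m + 1 := by omega
        rw [e1, g2 m le_rfl, Finset.sum_range_succ]; ring
      · rw [s1 _ (g.monotone (hmono j h)), g2 j h]
    · intro t ht
      show s (g t) = s (g (k (m+1))) + _
      rw [e1, g3 t (by linarith), s3 _ (by linarith)]; ring

lemma radial_aux {n : ℕ} (g : ℝ ≃o ℝ) (hg0 : g 0 = 0) (x : Euc n) :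
    ‖(g ‖x‖ / ‖x‖) • x‖ = g ‖x‖ := by
  have hg : 0 ≤ g ‖x‖ := by rw [← hg0]; exact g.monotone (norm_nonneg x)
  rw [norm_smul, Real.norm_of_nonneg (by positivity)]
  by_cases hx : x = 0
  · simp [hx, hg0]
  · have : ‖x‖ ≠ 0 := by simpa using hx
    field_simp

lemma radial_cont {n : ℕ} (g : ℝ ≃o ℝ) (hg0 : g 0 = 0) :
    Continuous (fun x : Euc n => (g ‖x‖ / ‖x‖) • x) := by
  have hgc : Continuous fun x : Euc n => g ‖x‖ := g.continuous.comp continuous_norm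
  rw [continuous_iff_continuousAt]
  intro x
  by_cases hx : x = 0
  · subst hx
    rw [ContinuousAt, smul_zero, tendsto_zero_iff_norm_tendsto_zero]
    simp_rw [radial_aux g hg0]
    have := hgc.tendsto 0
    simpa [hg0] using this
  · exact (hgc.continuousAt.div continuous_norm.continuousAt (by simpa using hx)).smul
      continuousAt_id

lemma radial_inv {n : ℕ} (g g' : ℝ ≃o ℝ) (hg0 : g 0 = 0) (h : ∀ t, g' (g t) = t) (x : Euc n) :
    (g' ‖(g ‖x‖ / ‖x‖) • x‖ / ‖(g ‖x‖ / ‖x‖) • x‖) • ((g ‖x‖ / ‖x‖) • x) = x := by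
  rw [radial_aux g hg0, h, smul_smul]
  by_cases hx : x = 0
  · simp [hx]
  · have h1 : 0 < ‖x‖ := by simpa using hx
    have h2 : 0 < g ‖x‖ := by rw [← hg0]; exact g.strictMono h1
    rw [div_mul_div_comm, mul_comm, div_self (by positivity), one_smul]

def radial (n : ℕ) (g : ℝ ≃o ℝ) (hg0 : g 0 = 0) : Euc n ≃ₜ Euc n where
  toFun x := (g ‖x‖ / ‖x‖) • x
  invFun x := (g.symm ‖x‖ / ‖x‖) • x
  left_inv x := radial_inv g g.symm hg0 (by simp) x
  right_inv x := radial_inv g.symm g ((g.symm_apply_eq).2 hg0.symm) (by simp) x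
  continuous_toFun := radial_cont g hg0
  continuous_invFun := radial_cont g.symm ((g.symm_apply_eq).2 hg0.symm)

lemma norm_radial {n : ℕ} (g : ℝ ≃o ℝ) (hg0 : g 0 = 0) (x : Euc n) :
    ‖radial n g hg0 x‖ = g ‖x‖ := radial_aux g hg0 x

lemma radial_def {n : ℕ} (g : ℝ ≃o ℝ) (hg0 : g 0 = 0) (x : Euc n) :
    radial n g hg0 x = (g ‖x‖ / ‖x‖) • x := rfl

lemma radial_of_eq {n : ℕ} (g : ℝ ≃o ℝ) (hg0 : g 0 = 0) (x : Euc n) (h : g ‖x‖ = ‖x‖) :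
    radial n g hg0 x = x := by
  rw [radial_def, h]
  by_cases hx : x = 0
  · simp [hx]
  · rw [div_self (by simpa using hx), one_smul]

instance factFin (n : ℕ) : Fact (Module.finrank ℝ (Euc (n+1)) = n + 1) :=
  ⟨finrank_euclideanSpace_fin⟩

theorem iod_sph {n : ℕ} (f : Euc n → Sph n) (O : Set (Euc n)) (hO : IsOpen O)
    (hf : ContinuousOn f O) (hinj : InjOn f O) : IsOpen (f '' O) := by
  rw [isOpen_iff_mem_nhds]
  rintro _ ⟨x, hx, rfl⟩
  set v : Sph n := -(f x)
  have hne : f x ≠ v := by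
    intro h
    have h1 : (f x : Euc (n+1)) = -(f x : Euc (n+1)) := congrArg Subtype.val h
    have h2 : (f x : Euc (n+1)) = 0 := by
      have h4 : (2:ℝ) • (f x : Euc (n+1)) = 0 := by
        rw [two_smul]; nth_rewrite 2 [h1]; exact add_neg_cancel _
      simpa using h4
    have h3 := (f x).2
    simp [h2] at h3
  set φ := stereographic' n v
  have hsrc : φ.source = {v}ᶜ := stereographic'_source v
  set O' := O ∩ f ⁻¹' {v}ᶜ
  have hO' : IsOpen O' := hf.isOpen_inter_preimage hO isOpen_compl_singleton
  have hsub : f '' O' ⊆ φ.source := by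
    rw [hsrc]; rintro _ ⟨y, hy, rfl⟩; exact hy.2
  have hop : IsOpen ((fun y => φ (f y)) '' O') := by
    apply inv_dom _ _ hO'
    · exact φ.continuousOn.comp (hf.mono inter_subset_left) fun y hy => hsub ⟨y, hy, rfl⟩
    · intro a ha b hb hab
      exact hinj ha.1 hb.1 (φ.injOn (hsub ⟨a, ha, rfl⟩) (hsub ⟨b, hb, rfl⟩) hab)
  have h2 : IsOpen (φ.symm '' ((fun y => φ (f y)) '' O')) := by
    apply φ.symm.isOpen_image_of_subset_source hop
    simp [φ, stereographic'_target]
  have h3 : φ.symm '' ((fun y => φ (f y)) '' O') = f '' O' := by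
    rw [image_image]
    apply image_congr
    intro y hy
    exact φ.left_inv (hsub ⟨y, hy, rfl⟩)
  rw [h3] at h2
  exact Filter.mem_of_superset (h2.mem_nhds ⟨x, ⟨hx, hne⟩, rfl⟩) (image_mono inter_subset_left)

lemma std_chart {n : ℕ} (p : Sph n) : ∃ Ψ : OnePoint (Euc n) ≃ₜ Sph n,
    Ψ ((0 : Euc n) : OnePoint (Euc n)) = p ∧ ∀ x : Euc n,
      inner ℝ (p : Euc (n+1)) (Ψ (x : OnePoint (Euc n)) : Euc (n+1)) * (‖x‖^2 + 4) = 4 - ‖x‖^2 := by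
  set v : Sph n := -p
  set φ := stereographic' n v
  have hsrc : φ.source = {v}ᶜ := stereographic'_source v
  have htgt : φ.target = univ := stereographic'_target v
  have hemb : IsOpenEmbedding φ.symm := φ.symm.isOpenEmbedding (by simpa using htgt)
  have hr : range φ.symm = {v}ᶜ := by
    rw [← hsrc, ← image_univ, ← htgt]; exact φ.symm.image_source_eq_target
  have hform : ∀ x : Euc n, inner ℝ (p : Euc (n+1)) (φ.symm x : Euc (n+1)) * (‖x‖^2 + 4) = 4 - ‖x‖^2 := by
    intro x
    have h := stereographic'_symm_apply (n := n) v x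
    simp only at h
    set U : _ ≃ₗᵢ[ℝ] _ := (OrthonormalBasis.fromOrthogonalSpanSingleton n
        (ne_zero_of_mem_unit_sphere v)).repr
    have hpv : (p : Euc (n+1)) = - v.1 := by simp [v]
    have hvn : inner ℝ v.1 v.1 = (1:ℝ) := by
      rw [real_inner_self_eq_norm_sq]; simp
    have hvU : inner ℝ v.1 (U.symm x : Euc (n+1)) = (0:ℝ) := 
      Submodule.mem_orthogonal_singleton_iff_inner_right.1 (U.symm x).2
    have hUn : ‖(U.symm x : Euc (n+1))‖ = ‖x‖ := by
      rw [Submodule.norm_coe]; exact U.symm.norm_map x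
    rw [hpv, h, inner_neg_left, inner_add_right, inner_smul_right, inner_smul_right,
      inner_smul_right, inner_smul_right, hvn, hvU, hUn]
    have : ‖x‖^2 + 4 ≠ 0 := by positivity
    field_simp
    ring
  refine ⟨OnePoint.equivOfIsEmbeddingOfRangeEq v φ.symm hemb.isEmbedding hr, ?_, ?_⟩
  · show φ.symm 0 = p
    have h := hform 0
    have : inner ℝ (p : Euc (n+1)) (φ.symm 0 : Euc (n+1)) = (1:ℝ) := by
      simp at h; linarith
    exact ((sphere_ext_iff _ _).2 this).symm
  · intro x; exact hform x

/-- `e` embeds the closed unit ball in the sphere. -/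
structure EmbB {n : ℕ} (e : Euc n → Sph n) : Prop where
  cont : ContinuousOn e (closedBall 0 1)
  inj : InjOn e (closedBall 0 1)

section
variable {n : ℕ} {e : Euc n → Sph n}

def einv (e : Euc n → Sph n) : Sph n → Euc n := Function.invFunOn e (closedBall 0 1)

lemma einv_e (he : EmbB e) {x : Euc n} (hx : ‖x‖ ≤ 1) : einv e (e x) = x :=
  he.inj.leftInvOn_invFunOn (by simpa using hx)

lemma einv_mem {y : Sph n} (hy : y ∈ e '' closedBall 0 1) : ‖einv e y‖ ≤ 1 := by
  simpa [einv] using Function.invFunOn_mem hy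

lemma e_einv {y : Sph n} (hy : y ∈ e '' closedBall 0 1) : e (einv e y) = y :=
  Function.invFunOn_eq hy

lemma einv_cont (he : EmbB e) : ContinuousOn (einv e) (e '' closedBall 0 1) :=
  contOn_inv_of_compact (isCompact_closedBall _ _) he.cont _
    fun x hx => einv_e he (by simpa using hx)

lemma e_mem_ball_iff (he : EmbB e) {x : Euc n} (hx : ‖x‖ ≤ 1) {s : ℝ} (hs : s ≤ 1) :
    e x ∈ e '' ball 0 s ↔ ‖x‖ < s := by
  constructor
  · rintro ⟨y, hy, hxy⟩
    have hy' : ‖y‖ < s := by simpa using hy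
    have := he.inj (by simpa using (hy'.le.trans hs)) (by simpa using hx) hxy
    rwa [← this]
  · intro h; exact ⟨x, by simpa using h, rfl⟩

lemma e_ball_open (he : EmbB e) {s : ℝ} (hs : s ≤ 1) : IsOpen (e '' ball 0 s) :=
  iod_sph e _ isOpen_ball (he.cont.mono ((ball_subset_ball hs).trans ball_subset_closedBall))
    (he.inj.mono ((ball_subset_ball hs).trans ball_subset_closedBall))

lemma nbhd_fact (he : EmbB e) (O : Set (Sph n)) (hO : IsOpen O) (hA : (e '' ball 0 1)ᶜ ⊆ O)
    (r0 : ℝ) (hr0 : r0 < 1) :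
    ∃ r, r0 < r ∧ r < 1 ∧ ∀ s, r ≤ s → (e '' ball 0 s)ᶜ ⊆ O := by
  have hK : IsCompact Oᶜ := hO.isClosed_compl.isCompact
  have hsub : Oᶜ ⊆ e '' ball 0 1 := compl_subset_comm.1 hA
  have hsub' : Oᶜ ⊆ e '' closedBall 0 1 := hsub.trans (image_mono ball_subset_closedBall)
  have hc : ContinuousOn (fun y => ‖einv e y‖) Oᶜ := ((einv_cont he).mono hsub').norm
  have hlt : ∀ y ∈ Oᶜ, ‖einv e y‖ < 1 := by
    intro y hy
    obtain ⟨x, hx, rfl⟩ := hsub hy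
    have hx' : ‖x‖ < 1 := by simpa using hx
    rwa [einv_e he hx'.le]
  obtain ⟨M, hM, hM1⟩ : ∃ M, M < 1 ∧ ∀ y ∈ Oᶜ, ‖einv e y‖ ≤ M := by
    rcases eq_empty_or_nonempty Oᶜ with h | h
    · exact ⟨0, by norm_num, by simp [h]⟩
    · obtain ⟨y, hy, hmax⟩ := hK.exists_isMaxOn h hc
      exact ⟨_, hlt y hy, fun z hz => hmax hz⟩
  have hm : max M r0 < 1 := max_lt hM hr0
  refine ⟨(max M r0 + 1) / 2, ?_, by linarith, ?_⟩
  · have := le_max_right M r0; linarith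
  · intro s hs
    rw [compl_subset_comm]
    intro y hy
    refine ⟨einv e y, ?_, e_einv (hsub' hy)⟩
    have := le_max_left M r0
    have := hM1 y hy
    simp only [mem_ball_zero_iff]; linarith

open Classical in
def pushF (e : Euc n → Sph n) (h : Euc n → Euc n) : Sph n → Sph n := fun y =>
  if y ∈ e '' closedBall 0 1 then e (h (einv e y)) else y

lemma pushF_e (he : EmbB e) (h : Euc n → Euc n) {x : Euc n} (hx : ‖x‖ ≤ 1) :
    pushF e h (e x) = e (h x) := by
  rw [pushF, if_pos ⟨x, by simpa using hx, rfl⟩, einv_e he hx]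

lemma pushF_off (he : EmbB e) (h : Euc n → Euc n) (h1 : ∀ x, 1 ≤ ‖x‖ → h x = x) {y : Sph n}
    (hy : y ∉ e '' ball 0 1) : pushF e h y = y := by
  rw [pushF]
  split_ifs with hy'
  · obtain ⟨x, hx, rfl⟩ := hy'
    have hx' : ‖x‖ ≤ 1 := by simpa using hx
    rw [e_mem_ball_iff he hx' le_rfl, not_lt] at hy
    rw [einv_e he hx', h1 _ hy]
  · rfl

lemma pushF_cont (he : EmbB e) (h : Euc n → Euc n) (hc : Continuous h)
    (h1 : ∀ x, 1 ≤ ‖x‖ → h x = x) (hB : ∀ x, ‖x‖ ≤ 1 → ‖h x‖ ≤ 1) : Continuous (pushF e h) := by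
  rw [← continuousOn_univ]
  have hcl : IsClosed (e '' closedBall 0 1) :=
    ((isCompact_closedBall _ _).image_of_continuousOn he.cont).isClosed
  have hu : (univ : Set (Sph n)) = e '' closedBall 0 1 ∪ (e '' ball 0 1)ᶜ := by
    rw [eq_comm, eq_univ_iff_forall]
    intro y
    by_cases hy : y ∈ e '' ball 0 1
    · left; exact image_mono ball_subset_closedBall hy
    · right; exact hy
  rw [hu]
  apply ContinuousOn.union_of_isClosed _ _ hcl (e_ball_open he le_rfl).isClosed_compl
  · have : ContinuousOn (fun y => e (h (einv e y))) (e '' closedBall 0 1) := by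
      apply he.cont.comp (hc.comp_continuousOn (einv_cont he))
      intro y hy
      simpa using hB _ (einv_mem hy)
    apply this.congr
    intro y hy
    rw [pushF, if_pos hy]
  · apply continuousOn_id.congr
    intro y hy
    exact pushF_off he h h1 hy

lemma pushF_inv (he : EmbB e) (h h' : Euc n → Euc n) (hB : ∀ x, ‖x‖ ≤ 1 → ‖h x‖ ≤ 1)
    (hh : ∀ x, h' (h x) = x) (y : Sph n) : pushF e h' (pushF e h y) = y := by
  by_cases hy : y ∈ e '' closedBall 0 1
  · obtain ⟨x, hx, rfl⟩ := hy
    have hx' : ‖x‖ ≤ 1 := by simpa using hx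
    rw [pushF_e he h hx', pushF_e he _ (hB x hx'), hh]
  · have : pushF e h y = y := by rw [pushF, if_neg hy]
    rw [this, pushF, if_neg hy]

lemma push_homeo (he : EmbB e) (h : Euc n ≃ₜ Euc n) (h1 : ∀ x, 1 ≤ ‖x‖ → h x = x)
    (hB : ∀ x, ‖h x‖ ≤ 1 ↔ ‖x‖ ≤ 1) : ∃ g : Sph n ≃ₜ Sph n,
      (∀ x, ‖x‖ ≤ 1 → g (e x) = e (h x)) ∧ (∀ y ∉ e '' ball 0 1, g y = y) := by
  have h1' : ∀ x, 1 ≤ ‖x‖ → h.symm x = x := fun x hx => (h.symm_apply_eq).2 (h1 x hx).symm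
  have hB' : ∀ x, ‖x‖ ≤ 1 → ‖h.symm x‖ ≤ 1 := by
    intro x hx; rw [← hB, h.apply_symm_apply]; exact hx
  refine ⟨⟨⟨pushF e h, pushF e h.symm, ?_, ?_⟩, ?_, ?_⟩, ?_, ?_⟩
  · intro y; exact pushF_inv he _ _ (fun x => (hB x).2) (by simp) y
  · intro y; exact pushF_inv he _ _ hB' (by simp) y
  · exact pushF_cont he _ h.continuous h1 (fun x => (hB x).2)
  · exact pushF_cont he _ h.symm.continuous h1' hB'
  · intro x hx; exact pushF_e he _ hx
  · intro y hy; exact pushF_off he _ h1 hy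

lemma far_infty (θ : OnePoint (Euc n) ≃ₜ Sph n) (O : Set (Sph n)) (hO : IsOpen O)
    (h : θ OnePoint.infty ∈ O) : ∃ L : ℝ, ∀ x : Euc n, L ≤ ‖x‖ → θ x ∈ O := by
  have h1 : IsOpen (θ ⁻¹' O) := hO.preimage θ.continuous
  have h2 := ((OnePoint.isOpen_iff_of_mem (s := θ ⁻¹' O) h).1 h1).2.isBounded
  obtain ⟨L, hL⟩ := h2.exists_norm_le
  refine ⟨L + 1, fun x hx => ?_⟩
  by_contra hne
  have := hL x (by simpa using hne)
  linarith

lemma squeeze (he : EmbB e) (r : ℝ) (hr0 : 0 < r) (hr : r < 1) (φ : Sph n ≃ₜ Sph n) (ε : ℝ)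
    (hε : 0 < ε) : ∃ τ : Sph n ≃ₜ Sph n, (∀ x, ‖x‖ ≤ r → τ (e x) = e x) ∧
      ∃ q, ∀ y ∉ e '' ball 0 1, φ (τ y) ∈ ball q ε := by
  obtain ⟨Ψ, hΨ0, -⟩ := std_chart (e 0)
  have hopen := e_ball_open he le_rfl
  have hcc : Continuous fun x : Euc n => Ψ x := Ψ.continuous.comp OnePoint.continuous_coe
  obtain ⟨a', ha', hsub⟩ : ∃ a' > 0, ∀ x : Euc n, ‖x‖ ≤ a' → Ψ x ∈ e '' ball 0 1 := by
    have h1 : (fun x : Euc n => Ψ x) ⁻¹' (e '' ball 0 1) ∈ 𝓝 (0 : Euc n) := by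
      apply (hopen.preimage hcc).mem_nhds
      show Ψ ((0 : Euc n) : OnePoint (Euc n)) ∈ e '' ball 0 1
      rw [hΨ0]; exact ⟨0, by simp, rfl⟩
    obtain ⟨a, ha, h⟩ := Metric.nhds_basis_closedBall.mem_iff.1 h1
    exact ⟨a, ha, fun x hx => h (by simpa using hx)⟩
  set a := a' / 2
  have ha : 0 < a := by positivity
  have haa : a < a' := by simp only [a]; linarith
  obtain ⟨ρ, hρ0, hρr, hρ⟩ : ∃ ρ, 0 < ρ ∧ ρ < r ∧ ∀ x : Euc n, ‖x‖ ≤ ρ →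
      ∃ z : Euc n, ‖z‖ < a ∧ Ψ z = e x := by
    have ho : IsOpen ((fun x : Euc n => Ψ x) '' ball 0 a) := by
      have := Ψ.isOpenMap _ (OnePoint.isOpenEmbedding_coe.isOpenMap (ball (0 : Euc n) a) isOpen_ball)
      rwa [image_image] at this
    have h1 : e ⁻¹' ((fun x : Euc n => Ψ x) '' ball 0 a) ∈ 𝓝 (0 : Euc n) := by
      have hce : ContinuousAt e 0 := he.cont.continuousAt (closedBall_mem_nhds _ one_pos)
      apply hce.preimage_mem_nhds
      apply ho.mem_nhds
      exact ⟨0, by simpa using ha, hΨ0⟩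
    obtain ⟨b, hb, h⟩ := Metric.nhds_basis_closedBall.mem_iff.1 h1
    refine ⟨min b (r/2), by positivity, (min_le_right _ _).trans_lt (by linarith), ?_⟩
    intro x hx
    obtain ⟨z, hz, hz2⟩ := h (show x ∈ closedBall 0 b by simpa using hx.trans (min_le_left _ _))
    exact ⟨z, by simpa using hz, hz2⟩
  -- h radial
  let k : ℕ → ℝ := fun i => if i = 0 then 0 else if i = 1 then ρ else 1
  let w : ℕ → ℝ := fun i => if i = 0 then r else 1 - r
  obtain ⟨g, g1, g2, g3⟩ := pl_iso k w 2
    (by intro i hi; interval_cases i <;> simp [k] <;> linarith)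
    (by intro i hi; interval_cases i <;> simp [w] <;> linarith)
  have gz : g 0 = 0 := g1 0 (by simp [k])
  have gρ : g ρ = r := by
    have := g2 1 (by norm_num); simpa [k, w] using this
  have g11 : g 1 = 1 := by
    have := g2 2 le_rfl; simpa [k, w, Finset.sum_range_succ] using this
  have gid : ∀ t, 1 ≤ t → g t = t := by
    intro t ht
    have := g3 t (by simpa [k] using ht)
    have e2 : k 2 = 1 := by simp [k]
    rw [e2, g11] at this; linarith
  obtain ⟨G, G1, G2⟩ := push_homeo he (radial n g gz)
    (fun x hx => radial_of_eq _ _ _ (gid _ hx))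
    (fun x => by rw [norm_radial, ← g11, g.le_iff_le, g11])
  set q := φ (G (Ψ OnePoint.infty))
  obtain ⟨L, hL⟩ := far_infty (Ψ.trans (G.trans φ)) (ball q ε) isOpen_ball (by simpa [q] using hε)
  obtain ⟨s, s1, s2, s3⟩ := stretch_iso a (a' - a) (max L a' - a) (by linarith)
    (by have := le_max_right L a'; linarith)
  have sz : s 0 = 0 := s1 0 ha.le
  have sa' : s a' = max L a' := by
    have : a + (a' - a) = a' := by ring
    rw [this] at s2; rw [s2]; ring
  set σ : Sph n ≃ₜ Sph n := (Ψ.symm.trans (radial n s sz).onePointCongr).trans Ψ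
  have hσ : ∀ x : Euc n, σ (Ψ x) = Ψ (radial n s sz x : Euc n) := by
    intro x
    simp only [σ, Homeomorph.trans_apply, Homeomorph.symm_apply_apply]; rfl
  have hσi : σ (Ψ OnePoint.infty) = Ψ OnePoint.infty := by
    simp only [σ, Homeomorph.trans_apply, Homeomorph.symm_apply_apply]; rfl
  refine ⟨(G.symm.trans σ).trans G, ?_, q, ?_⟩
  · intro x hx
    have hx1 : ‖(radial n g gz).symm x‖ ≤ ρ := by
      rw [← g.le_iff_le, gρ, ← norm_radial g gz, Homeomorph.apply_symm_apply]; exact hx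
    have e1 : G.symm (e x) = e ((radial n g gz).symm x) := by
      rw [G.symm_apply_eq, G1 _ (by linarith), Homeomorph.apply_symm_apply]
    obtain ⟨z, hz, hz2⟩ := hρ _ hx1
    simp only [Homeomorph.trans_apply]
    rw [e1, ← hz2, hσ, radial_of_eq _ _ _ (s1 _ hz.le), hz2, ← e1, G.apply_symm_apply]
  · intro y hy
    have e1 : G.symm y = y := (G.symm_apply_eq).2 (G2 y hy).symm
    simp only [Homeomorph.trans_apply]
    rw [e1]
    obtain ⟨z, rfl⟩ := Ψ.surjective y
    induction z using OnePoint.rec with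
    | infty => rw [hσi]; simpa [q] using hε
    | coe x =>
      rw [hσ]
      have hx : a' < ‖x‖ := by
        by_contra hh
        exact hy (hsub x (not_lt.1 hh))
      have := hL (radial n s sz x) (by
        rw [norm_radial]
        have := s.monotone hx.le
        rw [sa'] at this
        exact (le_max_left _ _).trans this)
      simpa using this

end

section
variable {n : ℕ} {e : Euc n → Sph n}

/-- radial embedding of Euclidean space onto the open unit ball, identity on the `r`-ball -/
lemma kappa_exists (r : ℝ) (hr0 : 0 < r) (hr : r < 1) : ∃ κ : Euc n → Euc n, Continuous κ ∧
    Function.Injective κ ∧ (∀ x, ‖x‖ ≤ r → κ x = x) ∧ range κ = ball 0 1 := by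
  let c : ℝ → ℝ := fun t => min t r + (1 - r) * (max (t - r) 0 / (1 + max (t - r) 0))
  have c1 : ∀ t ≤ r, c t = t := by
    intro t ht
    simp only [c]; rw [min_eq_left ht, max_eq_right (by linarith)]; simp
  have c2 : ∀ t, r ≤ t → c t = r + (1 - r) * ((t - r) / (1 + (t - r))) := by
    intro t ht
    simp only [c]; rw [min_eq_right ht, max_eq_left (by linarith)]
  have c2' : ∀ t, r ≤ t → c t = 1 - (1 - r) / (1 + (t - r)) := by
    intro t ht
    rw [c2 t ht]
    have : 1 + (t - r) ≠ 0 := by linarith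
    field_simp; ring
  have cc : Continuous c := by
    have : ∀ t : ℝ, 1 + max (t - r) 0 ≠ 0 := fun t => by positivity
    simp only [c]
    fun_prop (disch := exact this _)
  have c3 : ∀ t, r ≤ t → r ≤ c t ∧ c t < 1 := by
    intro t ht
    constructor
    · rw [c2 t ht]
      have : 0 ≤ (1 - r) * ((t - r) / (1 + (t - r))) :=
        mul_nonneg (by linarith) (div_nonneg (by linarith) (by linarith))
      linarith
    · rw [c2' t ht]
      have : 0 < (1 - r) / (1 + (t - r)) := div_pos (by linarith) (by linarith)
      linarith
  have cmono : StrictMono c := by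
    intro s t hst
    rcases le_or_gt t r with h | h
    · rw [c1 t h, c1 s (by linarith)]; exact hst
    rcases le_or_gt s r with h' | h'
    · rcases eq_or_lt_of_le h' with h'' | h''
      · rw [c1 s h', c2 t h.le]
        have : 0 < (1 - r) * ((t - r) / (1 + (t - r))) :=
          mul_pos (by linarith) (div_pos (by linarith) (by linarith))
        linarith
      · rw [c1 s h']; linarith [(c3 t h.le).1]
    · rw [c2' s h'.le, c2' t h.le]
      have : (1 - r) / (1 + (t - r)) < (1 - r) / (1 + (s - r)) := by
        apply div_lt_div_of_pos_left <;> linarith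
      linarith
  have c0 : c 0 = 0 := c1 0 hr0.le
  have cpos : ∀ t, 0 ≤ t → 0 ≤ c t := fun t ht => c0 ▸ cmono.monotone ht
  let κ : Euc n → Euc n := fun x => (c ‖x‖ / ‖x‖) • x
  have k1 : ∀ x, ‖x‖ ≤ r → κ x = x := by
    intro x hx
    simp only [κ]; rw [c1 _ hx]
    by_cases h : x = 0
    · simp [h]
    · rw [div_self (by simpa using h), one_smul]
  have kn : ∀ x, ‖κ x‖ = c ‖x‖ := by
    intro x
    simp only [κ]
    rw [norm_smul, Real.norm_of_nonneg (div_nonneg (cpos _ (norm_nonneg _)) (norm_nonneg _))]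
    by_cases h : x = 0
    · simp [h, c0]
    · have : ‖x‖ ≠ 0 := by simpa using h
      field_simp
  refine ⟨κ, ?_, ?_, k1, ?_⟩
  · rw [continuous_iff_continuousAt]
    intro x
    by_cases h : x = 0
    · subst h
      have : κ =ᶠ[𝓝 0] id := by
        filter_upwards [closedBall_mem_nhds (0 : Euc n) hr0] with y hy
        exact k1 y (by simpa using hy)
      exact continuousAt_id.congr this.symm
    · exact ((cc.comp continuous_norm).continuousAt.div continuous_norm.continuousAt
        (by simpa using h)).smul continuousAt_id
  · intro x y hxy
    have h1 : ‖x‖ = ‖y‖ := cmono.injective (by rw [← kn, ← kn, hxy])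
    by_cases h : x = 0
    · subst h; rw [norm_zero] at h1; exact (norm_eq_zero.1 h1.symm).symm
    · have hx : 0 < ‖x‖ := by simpa using h
      have hc : 0 < c ‖x‖ := c0 ▸ cmono hx
      simp only [κ, ← h1] at hxy
      exact smul_right_injective _ (div_pos hc hx).ne' hxy
  · apply Subset.antisymm
    · rintro _ ⟨x, rfl⟩
      rw [mem_ball_zero_iff, kn]
      rcases le_or_gt ‖x‖ r with h | h
      · rw [c1 _ h]; linarith
      · exact (c3 _ h.le).2
    · intro y hy
      have hy1 : ‖y‖ < 1 := by simpa using hy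
      rcases le_or_gt ‖y‖ r with h | h
      · exact ⟨y, k1 y h⟩
      · have hy0 : 0 < ‖y‖ := hr0.trans h
        set t := r + (1 - r) / (1 - ‖y‖) - 1 with ht
        have h1y : 0 < 1 - ‖y‖ := by linarith
        have hle : 1 ≤ (1 - r) / (1 - ‖y‖) := by
          rw [le_div_iff₀ h1y]; linarith
        have htr : r ≤ t := by linarith
        have ct : c t = ‖y‖ := by
          rw [c2' t htr, ht]
          have h1r : 1 - r ≠ 0 := by linarith
          have : 1 + (r + (1 - r) / (1 - ‖y‖) - 1 - r) = (1 - r) / (1 - ‖y‖) := by ring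
          rw [this]; field_simp; ring
        have hnx : ‖(t / ‖y‖) • y‖ = t := by
          rw [norm_smul, Real.norm_of_nonneg (div_nonneg (by linarith) hy0.le)]; field_simp
        refine ⟨(t / ‖y‖) • y, ?_⟩
        have : t ≠ 0 := by linarith
        simp only [κ]
        rw [hnx, ct, smul_smul, div_mul_div_comm, mul_comm, div_self (by positivity), one_smul]

theorem schoenflies [Nontrivial (Euc n)] (he : EmbB e) (r : ℝ) (hr0 : 0 < r) (hr : r < 1) :
    ∃ Ψ : OnePoint (Euc n) ≃ₜ Sph n, ∀ x : Euc n, ‖x‖ ≤ r → Ψ x = e x := by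
  have step : ∀ (k : ℕ) (p : {p : (Sph n ≃ₜ Sph n) × ℝ // 0 < p.2 ∧ p.2 < 1}),
      ∃ p' : {p : (Sph n ≃ₜ Sph n) × ℝ // 0 < p.2 ∧ p.2 < 1},
        p.1.2 < p'.1.2 ∧ 1 - (1/2:ℝ)^k < p'.1.2 ∧ (∀ x, ‖x‖ ≤ p.1.2 → p'.1.1 (e x) = p.1.1 (e x)) ∧
        ∃ q, p'.1.1 '' (e '' ball 0 p'.1.2)ᶜ ⊆ ball q ((1/2)^k) := by
    rintro k ⟨⟨φ, s⟩, hs0, hs1⟩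
    obtain ⟨τ, t1, q, t2⟩ := squeeze he s hs0 hs1 φ ((1/2)^k) (by positivity)
    obtain ⟨r', h1, h2, h3⟩ := nbhd_fact he ((τ.trans φ) ⁻¹' ball q ((1/2)^k))
      (isOpen_ball.preimage (τ.trans φ).continuous) (fun y hy => t2 y hy)
      (max s (1 - (1/2)^k)) (max_lt hs1 (by simp))
    refine ⟨⟨⟨τ.trans φ, r'⟩, ?_, h2⟩, (le_max_left _ _).trans_lt h1, (le_max_right _ _).trans_lt h1,
      ?_, q, ?_⟩
    · exact hs0.trans ((le_max_left _ _).trans_lt h1)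
    · intro x hx
      simp only [Homeomorph.trans_apply]
      rw [t1 x hx]
    · rintro _ ⟨y, hy, rfl⟩
      exact h3 r' le_rfl hy
  choose stp s1 s2 s3 s4 using step
  let seq : ℕ → {p : (Sph n ≃ₜ Sph n) × ℝ // 0 < p.2 ∧ p.2 < 1} := fun k =>
    Nat.rec ⟨⟨Homeomorph.refl _, r⟩, hr0, hr⟩ (fun k p => stp k p) k
  let φ : ℕ → (Sph n ≃ₜ Sph n) := fun k => (seq k).1.1
  let R : ℕ → ℝ := fun k => (seq k).1.2
  have R0 : R 0 = r := rfl
  have Rpos : ∀ k, 0 < R k := fun k => (seq k).2.1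
  have Rlt : ∀ k, R k < 1 := fun k => (seq k).2.2
  have Rsm : StrictMono R := strictMono_nat_of_lt_succ fun k => s1 k (seq k)
  have Rbig : ∀ k, 1 - (1/2:ℝ)^k < R (k+1) := fun k => s2 k (seq k)
  have hφ : ∀ k x, ‖x‖ ≤ R k → φ (k+1) (e x) = φ k (e x) := fun k => s3 k (seq k)
  have hsm : ∀ k, ∃ q, φ (k+1) '' (e '' ball 0 (R (k+1)))ᶜ ⊆ ball q ((1/2)^k) :=
    fun k => s4 k (seq k)
  have hφ' : ∀ k j x, k ≤ j → ‖x‖ ≤ R k → φ j (e x) = φ k (e x) := by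
    intro k j x hkj
    induction j, hkj using Nat.le_induction with
    | base => intro _; rfl
    | succ j hkj ih => intro hx; rw [hφ j x (hx.trans (Rsm.monotone hkj)), ih hx]
  have hR : ∀ x : ℝ, x < 1 → ∃ k, x < R k := by
    intro x hx
    obtain ⟨k, hk⟩ := exists_pow_lt_of_lt_one (sub_pos.2 hx) (by norm_num : (1/2:ℝ) < 1)
    exact ⟨k+1, by linarith [Rbig k]⟩
  have hR' : ∀ x : Euc n, ∃ k, ‖x‖ < 1 → ‖x‖ ≤ R k := by
    intro x
    by_cases h : ‖x‖ < 1
    · obtain ⟨k, hk⟩ := hR _ h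
      exact ⟨k, fun _ => hk.le⟩
    · exact ⟨0, fun h' => absurd h' h⟩
  choose K hK using hR'
  let Φ : Euc n → Sph n := fun x => φ (K x) (e x)
  have hΦ : ∀ k x, ‖x‖ ≤ R k → Φ x = φ k (e x) := by
    intro k x hx
    have := hK x (hx.trans_lt (Rlt k))
    simp only [Φ]
    rcases le_total k (K x) with h | h
    · exact hφ' _ _ _ h hx
    · exact (hφ' _ _ _ h this).symm
  -- the limit point
  let N : ℕ → Set (Sph n) := fun k => φ k '' (e '' ball 0 (R k))ᶜ
  have Nmem : ∀ k y, y ∈ N k ↔ y ∉ (fun x => φ k (e x)) '' ball 0 (R k) := by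
    intro k y
    simp only [N]
    rw [image_compl_eq (φ k).bijective, image_image, mem_compl_iff]
  have Nanti : ∀ k, N (k+1) ⊆ N k := by
    intro k y hy
    refine (Nmem k y).2 fun hy' => (Nmem (k+1) y).1 hy ?_
    obtain ⟨x, hx, rfl⟩ := hy'
    have hx' : ‖x‖ < R k := by simpa using hx
    exact ⟨x, by simpa using hx'.trans (Rsm (Nat.lt_succ_self k)), hφ k x hx'.le⟩
  have Ncl : ∀ k, IsClosed (N k) := fun k =>
    (φ k).isClosedMap _ (e_ball_open he (Rlt k).le).isClosed_compl
  have Nne : ∀ k, (N k).Nonempty := by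
    intro k
    obtain ⟨u, hu⟩ := (NormedSpace.sphere_nonempty (x := (0 : Euc n)) (r := 1)).2 zero_le_one
    have hu' : ‖u‖ = 1 := by simpa using hu
    refine ⟨_, mem_image_of_mem _ (show e u ∈ (e '' ball 0 (R k))ᶜ from ?_)⟩
    rw [mem_compl_iff, e_mem_ball_iff he hu'.le (Rlt k).le, hu']
    exact not_lt.2 (Rlt k).le
  obtain ⟨p, hp⟩ := IsCompact.nonempty_iInter_of_sequence_nonempty_isCompact_isClosed N Nanti Nne
    (Ncl 0).isCompact Ncl
  rw [mem_iInter] at hp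
  have hpu : ∀ y, (∀ k, y ∈ N k) → y = p := by
    intro y hy
    by_contra hne
    have hd : 0 < dist y p := dist_pos.2 hne
    obtain ⟨k, hk⟩ := exists_pow_lt_of_lt_one (half_pos hd) (by norm_num : (1/2:ℝ) < 1)
    obtain ⟨q, hq⟩ := hsm k
    have h1 := hq (hy (k+1))
    have h2 := hq (hp (k+1))
    rw [mem_ball] at h1 h2
    have := dist_triangle_right y p q
    linarith
  have Φimg : Φ '' ball 0 1 = {p}ᶜ := by
    apply Subset.antisymm
    · rintro _ ⟨x, hx, rfl⟩ hxp
      obtain ⟨k, hk⟩ := hR ‖x‖ (by simpa using hx)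
      have := (Nmem k p).1 (hp k)
      apply this
      exact ⟨x, by simpa using hk, (hΦ k x hk.le).symm.trans hxp⟩
    · intro y hy
      have : ∃ k, y ∉ N k := by
        by_contra! h; exact hy (hpu y h)
      obtain ⟨k, hk⟩ := this
      rw [Nmem, not_not] at hk
      obtain ⟨x, hx, rfl⟩ := hk
      have hx' : ‖x‖ < R k := by simpa using hx
      exact ⟨x, by simpa using hx'.trans (Rlt k), hΦ k x hx'.le⟩
  have Φinj : InjOn Φ (ball 0 1) := by
    intro x hx y hy hxy
    have hx' : ‖x‖ < 1 := by simpa using hx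
    have hy' : ‖y‖ < 1 := by simpa using hy
    obtain ⟨k, hk⟩ := hR (max ‖x‖ ‖y‖) (max_lt hx' hy')
    rw [hΦ k x ((le_max_left _ _).trans hk.le), hΦ k y ((le_max_right _ _).trans hk.le)] at hxy
    exact he.inj (by simpa using hx'.le) (by simpa using hy'.le) ((φ k).injective hxy)
  have Φcont : ContinuousOn Φ (ball 0 1) := by
    intro x hx
    have hx' : ‖x‖ < 1 := by simpa using hx
    obtain ⟨k, hk⟩ := hR ‖x‖ hx'
    have h1 : Φ =ᶠ[𝓝 x] fun x => φ k (e x) := by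
      filter_upwards [isOpen_ball.mem_nhds (show x ∈ ball (0 : Euc n) (R k) by simpa using hk)]
        with y hy
      exact hΦ k y (by simpa using (mem_ball_zero_iff.1 hy).le)
    have h2 : ContinuousAt e x := he.cont.continuousAt
      (Filter.mem_of_superset (isOpen_ball.mem_nhds hx) ball_subset_closedBall)
    exact (((φ k).continuous.continuousAt.comp h2).congr h1.symm).continuousWithinAt
  obtain ⟨κ, kc, ki, kr, kran⟩ := kappa_exists (n := n) r hr0 hr
  have kmem : ∀ x, κ x ∈ ball (0 : Euc n) 1 := fun x => kran ▸ mem_range_self x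
  have fc : Continuous (Φ ∘ κ) := by
    rw [← continuousOn_univ]
    exact Φcont.comp kc.continuousOn fun x _ => kmem x
  have fi : Function.Injective (Φ ∘ κ) := fun x y h => ki (Φinj (kmem x) (kmem y) h)
  have fo : IsOpenMap (Φ ∘ κ) := fun O hO => iod_sph _ O hO fc.continuousOn fi.injOn
  have fr : range (Φ ∘ κ) = {p}ᶜ := by rw [range_comp, kran, Φimg]
  refine ⟨OnePoint.equivOfIsEmbeddingOfRangeEq p (Φ ∘ κ)
    (IsOpenEmbedding.of_continuous_injective_isOpenMap fc fi fo).isEmbedding fr, ?_⟩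
  intro x hx
  show Φ (κ x) = e x
  rw [kr x hx, hΦ 0 x hx]; rfl

theorem flat_of_emb [Nontrivial (Euc n)] (he : EmbB e) (ρ : ℝ) (h0 : 0 < ρ) (h1 : ρ < 1) :
    ∃ F : Sph n ≃ₜ Sph n, F '' (e '' sphere 0 ρ) = {x : Sph n | (x : Euc (n+1)) (Fin.last n) = 0} := by
  obtain ⟨Ψ, hΨ⟩ := schoenflies he ρ h0 h1
  let p : Sph n := ⟨EuclideanSpace.single (Fin.last n) 1, by simp⟩
  obtain ⟨Θ, -, hΘ⟩ := std_chart p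
  have hin : ∀ y : Euc (n+1), inner ℝ (p : Euc (n+1)) y = y (Fin.last n) := by
    intro y; simp only [p]; rw [EuclideanSpace.inner_single_left]; simp
  obtain ⟨g, g1, g2, -⟩ := stretch_iso 0 ρ 2 h0 two_pos
  have gz : g 0 = 0 := g1 0 le_rfl
  have gρ : g ρ = 2 := by simpa using g2
  set H := radial n g gz
  refine ⟨(Ψ.symm.trans H.onePointCongr).trans Θ, ?_⟩
  have hF : ∀ x : Euc n, ((Ψ.symm.trans H.onePointCongr).trans Θ) (Ψ x) = Θ (H x : Euc n) := by
    intro x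
    simp only [Homeomorph.trans_apply, Homeomorph.symm_apply_apply]; rfl
  have hFi : ((Ψ.symm.trans H.onePointCongr).trans Θ) (Ψ OnePoint.infty) = Θ OnePoint.infty := by
    simp only [Homeomorph.trans_apply, Homeomorph.symm_apply_apply]; rfl
  have hq : ∀ x : Euc n, (Θ x : Euc (n+1)) (Fin.last n) = 0 ↔ ‖x‖ = 2 := by
    intro x
    have h := hΘ x
    rw [hin] at h
    constructor
    · intro h3; rw [h3] at h
      have : (‖x‖ - 2) * (‖x‖ + 2) = 0 := by linarith
      rcases mul_eq_zero.1 this with h4 | h4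
      · linarith
      · linarith [norm_nonneg x]
    · intro h3; rw [h3] at h
      rcases mul_eq_zero.1 (by linarith : (Θ x : Euc (n+1)) (Fin.last n) * (2^2+4) = 0) with h4 | h4
      · exact h4
      · norm_num at h4
  have hqi : (Θ OnePoint.infty : Euc (n+1)) (Fin.last n) ≠ 0 := by
    intro h
    obtain ⟨L, hL⟩ := far_infty Θ {x | (x : Euc (n+1)) (Fin.last n) ∈ ball 0 (3/5)}
      (isOpen_ball.preimage (by fun_prop)) (by simp [h])
    obtain ⟨u, hu⟩ := (NormedSpace.sphere_nonempty (x := (0 : Euc n)) (r := max L 4)).2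
      (le_trans (by norm_num) (le_max_right L 4))
    have hu' : ‖u‖ = max L 4 := by simpa using hu
    have h2 := hL u (hu' ▸ le_max_left _ _)
    have h3 := hΘ u
    rw [hin] at h3
    simp only [mem_ofPred_eq, mem_ball_zero_iff, Real.norm_eq_abs, abs_lt] at h2
    have h4 : 4 ≤ ‖u‖ := hu' ▸ le_max_right _ _
    nlinarith
  ext y
  constructor
  · rintro ⟨_, ⟨x, hx, rfl⟩, rfl⟩
    have hx' : ‖x‖ = ρ := by simpa using hx
    rw [← hΨ x hx'.le, hF]
    simp only [mem_ofPred_eq]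
    rw [hq, norm_radial, hx', gρ]
  · intro hy
    obtain ⟨z, rfl⟩ := ((Ψ.symm.trans H.onePointCongr).trans Θ).surjective y
    obtain ⟨z, rfl⟩ := Ψ.surjective z
    induction z using OnePoint.rec with
    | infty => rw [hFi] at hy; exact absurd hy hqi
    | coe x =>
      rw [hF] at hy
      simp only [mem_ofPred_eq] at hy
      rw [hq, norm_radial, ← gρ] at hy
      have hx := g.injective hy
      exact mem_image_of_mem _ ⟨x, by simpa using hx, (hΨ x hx.le).symm⟩

end

section
variable {n : ℕ} {e : Euc n → Sph n}

/-- the exterior of a round ball in a one-point-compactified chart is a nice ball -/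
lemma ext_ball (Ψ : OnePoint (Euc n) ≃ₜ Sph n) (c : ℝ) (hc : 0 < c) :
    ∃ e' : Euc n → Sph n, EmbB e' ∧
      (∀ s, 0 < s → Set.image e' (ball 0 s) = ((fun x : Euc n => Ψ x) '' closedBall 0 (c / s))ᶜ) := by
  classical
  let I : Euc n → Euc n := fun x => (c / ‖x‖^2) • x
  have hIn : ∀ x, x ≠ 0 → ‖I x‖ = c / ‖x‖ := by
    intro x hx
    have : ‖x‖ ≠ 0 := by simpa using hx
    simp only [I]
    rw [norm_smul, Real.norm_of_nonneg (by positivity)]; field_simp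
  have hII : ∀ x, x ≠ 0 → I (I x) = x := by
    intro x hx
    have h0 : ‖x‖ ≠ 0 := by simpa using hx
    have h1 := hIn x hx
    have h2 : I (I x) = (c / ‖I x‖^2) • I x := rfl
    rw [h2, h1]
    simp only [I]
    rw [smul_smul]
    have : c / (c / ‖x‖) ^ 2 * (c / ‖x‖ ^ 2) = 1 := by field_simp
    rw [this, one_smul]
  have hI0 : ∀ x, x ≠ 0 → I x ≠ 0 := by
    intro x hx h
    have h1 := hIn x hx
    have : 0 < ‖x‖ := by simpa using hx
    rw [h, norm_zero] at h1
    have : 0 < c / ‖x‖ := by positivity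
    linarith
  let e' : Euc n → Sph n := fun x => if x = 0 then Ψ OnePoint.infty else Ψ (I x : Euc n)
  have h0 : e' 0 = Ψ OnePoint.infty := by simp [e']
  have hne : ∀ x, x ≠ 0 → e' x = Ψ (I x : Euc n) := fun x hx => by simp [e', hx]
  have hcc : Continuous fun x : Euc n => Ψ x := Ψ.continuous.comp OnePoint.continuous_coe
  have hcont : Continuous e' := by
    rw [continuous_iff_continuousAt]
    intro x
    by_cases hx : x = 0
    · subst hx
      rw [ContinuousAt, h0, tendsto_def]
      intro s hs
      obtain ⟨O, hOs, hO, hmem⟩ := _root_.mem_nhds_iff.1 hs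
      obtain ⟨L, hL⟩ := far_infty Ψ O hO hmem
      have hL0 : 0 < c / max L 1 := by positivity
      filter_upwards [closedBall_mem_nhds (0 : Euc n) hL0] with y hy
      apply hOs
      by_cases hy0 : y = 0
      · rw [hy0, h0]; exact hmem
      · rw [hne y hy0]
        apply hL
        rw [hIn y hy0]
        have hy1 : 0 < ‖y‖ := by simpa using hy0
        have hy2 : ‖y‖ ≤ c / max L 1 := by simpa using hy
        rw [le_div_iff₀ (by positivity)] at hy2
        rw [le_div_iff₀ hy1]
        calc L * ‖y‖ ≤ max L 1 * ‖y‖ := by gcongr; exact le_max_left _ _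
          _ ≤ c := by linarith
    · have h1 : e' =ᶠ[𝓝 x] fun x => Ψ (I x : Euc n) := by
        filter_upwards [isOpen_ne.mem_nhds hx] with y hy using hne y hy
      have h2 : ContinuousAt I x := by
        have : ‖x‖^2 ≠ 0 := by simpa using hx
        have h3 : ContinuousAt (fun y : Euc n => c / ‖y‖^2) x :=
          continuousAt_const.div (by fun_prop) this
        exact h3.smul continuousAt_id
      exact (hcc.continuousAt.comp (f := I) h2).congr h1.symm
  have hinj : Function.Injective e' := by
    intro x y hxy
    by_cases hx : x = 0 <;> by_cases hy : y = 0
    · rw [hx, hy]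
    · rw [hx, h0, hne y hy] at hxy
      exact absurd (Ψ.injective hxy) (OnePoint.infty_ne_coe _)
    · rw [hy, h0, hne x hx] at hxy
      exact absurd (Ψ.injective hxy) (OnePoint.coe_ne_infty _)
    · rw [hne x hx, hne y hy] at hxy
      have := OnePoint.coe_injective (Ψ.injective hxy)
      rw [← hII x hx, this, hII y hy]
  refine ⟨e', ⟨hcont.continuousOn, hinj.injOn⟩, ?_⟩
  intro s hs
  ext y
  constructor
  · rintro ⟨x, hx, rfl⟩ ⟨z, hz, hzx⟩
    have hx' : ‖x‖ < s := by simpa using hx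
    have hz' : ‖z‖ ≤ c / s := by simpa using hz
    by_cases hx0 : x = 0
    · rw [hx0, h0] at hzx
      exact absurd (Ψ.injective hzx) (OnePoint.coe_ne_infty _)
    · rw [hne x hx0] at hzx
      have hzI := OnePoint.coe_injective (Ψ.injective hzx)
      rw [hzI, hIn x hx0] at hz'
      have hxp : 0 < ‖x‖ := by simpa using hx0
      have : c / s < c / ‖x‖ := div_lt_div_of_pos_left hc hxp hx'
      linarith
  · intro hy
    obtain ⟨z, rfl⟩ := Ψ.surjective y
    induction z using OnePoint.rec with
    | infty => exact ⟨0, by simpa using hs, h0⟩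
    | coe z =>
      have hz : c / s < ‖z‖ := by
        by_contra h
        exact hy ⟨z, by simpa using h, rfl⟩
      have hcs : 0 < c / s := by positivity
      have hz0 : z ≠ 0 := by
        rintro rfl; rw [norm_zero] at hz; linarith
      refine ⟨I z, ?_, by rw [hne _ (hI0 z hz0), hII z hz0]⟩
      rw [mem_ball_zero_iff, hIn z hz0, div_lt_iff₀ (by linarith)]
      rw [div_lt_iff₀ hs] at hz; linarith

/-- null families accumulate with small diameters near the boundary -/
lemma fact_N (he : EmbB e) (C : ℕ → Set (Sph n)) (L : Set ℕ) (hCc : ∀ l ∈ L, IsClosed (C l))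
    (hCs : ∀ l ∈ L, C l ⊆ e '' ball 0 1) (hnull : ∀ δ > 0, {l ∈ L | δ ≤ diam (C l)}.Finite)
    (δ s0 : ℝ) (hδ : 0 < δ) (hs0 : s0 < 1) :
    ∃ s, s0 < s ∧ s < 1 ∧ ∀ l ∈ L, ∀ x, ‖x‖ ≤ 1 → e x ∈ C l → s ≤ ‖x‖ →
      ∀ y z, ‖y‖ ≤ 1 → ‖z‖ ≤ 1 → e y ∈ C l → e z ∈ C l → dist y z < δ := by
  have hK : IsCompact (e '' closedBall 0 1) :=
    (isCompact_closedBall _ _).image_of_continuousOn he.cont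
  have huc := hK.uniformContinuousOn_of_continuous (einv_cont he)
  rw [Metric.uniformContinuousOn_iff] at huc
  obtain ⟨η, hη, hη2⟩ := huc δ hδ
  have hfin := hnull η hη
  have hcl : IsClosed (⋃ l ∈ {l ∈ L | η ≤ diam (C l)}, C l) :=
    hfin.isClosed_biUnion fun l hl => hCc l hl.1
  obtain ⟨s, h1, h2, h3⟩ := nbhd_fact he (⋃ l ∈ {l ∈ L | η ≤ diam (C l)}, C l)ᶜ hcl.isOpen_compl
    (compl_subset_compl.2 (iUnion₂_subset fun l hl => hCs l hl.1)) s0 hs0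
  refine ⟨s, h1, h2, ?_⟩
  intro l hl x hx hxC hsx y z hy hz hyC hzC
  have hd : diam (C l) < η := by
    by_contra hcon
    have hx2 : e x ∈ (e '' ball 0 s)ᶜ := by
      rw [mem_compl_iff, e_mem_ball_iff he hx h2.le]; exact not_lt.2 hsx
    have := h3 s le_rfl hx2
    exact this (mem_iUnion₂.2 ⟨l, ⟨hl, not_lt.1 hcon⟩, hxC⟩)
  have hb : Bornology.IsBounded (C l) := (hCc l hl).isCompact.isBounded
  have := hη2 (e y) ⟨y, by simpa using hy, rfl⟩ (e z) ⟨z, by simpa using hz, rfl⟩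
    ((dist_le_diam_of_mem hb hyC hzC).trans_lt hd)
  rwa [einv_e he hy, einv_e he hz] at this

lemma dist_dir (a b : ℝ) (x y : Euc n) (hb0 : 0 ≤ b) (hb : b ≤ 2) (hx : x ≠ 0) (hy : 1/2 ≤ ‖y‖) :
    dist ((a / ‖x‖) • x) ((b / ‖y‖) • y) ≤ |a - b| + 8 * dist x y := by
  have hx0 : 0 < ‖x‖ := by simpa using hx
  have hy0 : 0 < ‖y‖ := by linarith
  have e1 : (a / ‖x‖) • x - (b / ‖y‖) • y =
      ((a - b) / ‖x‖) • x + (b / ‖y‖) • (((‖y‖ - ‖x‖) / ‖x‖) • x + (x - y)) := by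
    rw [smul_add, smul_sub, smul_smul]
    have : (a / ‖x‖) = (a - b) / ‖x‖ + b / ‖y‖ * ((‖y‖ - ‖x‖) / ‖x‖) + b / ‖y‖ := by
      field_simp; ring
    rw [this, add_smul, add_smul]; abel
  have n1 : ∀ t : ℝ, ‖(t / ‖x‖) • x‖ = |t| := by
    intro t; rw [norm_smul, norm_div, norm_norm, Real.norm_eq_abs]; field_simp
  have hby : b / ‖y‖ ≤ 4 := by rw [div_le_iff₀ hy0]; linarith
  rw [dist_eq_norm, e1, dist_eq_norm]
  have h3 : |‖y‖ - ‖x‖| ≤ ‖x - y‖ := by rw [norm_sub_rev]; exact abs_norm_sub_norm_le _ _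
  calc _ ≤ ‖((a - b) / ‖x‖) • x‖ + ‖(b / ‖y‖) • (((‖y‖ - ‖x‖) / ‖x‖) • x + (x - y))‖ :=
        norm_add_le _ _
    _ ≤ |a - b| + (b / ‖y‖) * (|‖y‖ - ‖x‖| + ‖x - y‖) := by
        rw [n1, norm_smul, Real.norm_of_nonneg (by positivity)]
        gcongr
        exact (norm_add_le _ _).trans (by rw [n1])
    _ ≤ |a - b| + 4 * (‖x - y‖ + ‖x - y‖) := by gcongr
    _ = _ := by ring

end

section
variable {n : ℕ} {e : Euc n → Sph n}

lemma knots (step : ℝ → ℝ → Prop) (hstep : ∀ s < 1, ∃ s', s < s' ∧ s' < 1 ∧ step s s')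
    (h1 : ∀ s, step s 1) (r : ℝ) (hr : r < 1) (m : ℕ) (hm : 0 < m) :
    ∃ k : ℕ → ℝ, k 0 = r ∧ k m = 1 ∧ ∀ i < m, k i < k (i+1) ∧ step (k i) (k (i+1)) := by
  choose! nx hn1 hn2 hn3 using hstep
  let q : ℕ → ℝ := fun i => Nat.rec r (fun _ s => nx s) i
  have q1 : ∀ i, q i < 1 := by
    intro i
    induction i with
    | zero => exact hr
    | succ i ih => exact hn2 _ ih
  refine ⟨fun i => if i < m then q i else 1, by simp [hm, q], by simp, ?_⟩
  intro i hi
  simp only [hi, if_true]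
  split_ifs with h
  · exact ⟨hn1 _ (q1 i), hn3 _ (q1 i)⟩
  · exact ⟨q1 i, h1 _⟩

theorem lemmaA [Nontrivial (Euc n)] (he : EmbB e) (C : ℕ → Set (Sph n)) (L : Set ℕ)
    (hCc : ∀ l ∈ L, IsClosed (C l))
    (hCs : ∀ l ∈ L, C l ⊆ e '' ball 0 1) (hnull : ∀ δ > 0, {l ∈ L | δ ≤ diam (C l)}.Finite)
    (O : Set (Sph n)) (hO : IsOpen O) (hAO : (e '' ball 0 1)ᶜ ⊆ O) (G : Sph n → Sph n)
    (hG : ContinuousOn G O) (ε : ℝ) (hε : 0 < ε) :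
    ∃ (N : Set (Sph n)) (f : Sph n → Sph n) (e' : Euc n → Sph n),
      IsClosed N ∧ N ⊆ O ∧ (e '' ball 0 1)ᶜ ⊆ N ∧
      ContinuousOn f (e '' closedBall 0 1) ∧ InjOn f (e '' closedBall 0 1) ∧
      (∀ y ∉ N, f y = y) ∧ (∀ y ∈ N, y ∈ e '' closedBall 0 1 → f y ∈ N) ∧
      EmbB e' ∧ Set.image e' (closedBall 0 1) ⊆ N ∧
      f '' (e '' closedBall 0 1) = (Set.image e' (ball 0 (1/2)))ᶜ ∧
      ∀ l ∈ L, (∀ y ∈ C l, f y = y) ∨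
        ((∀ y ∈ C l, f y ∈ O) ∧ ∀ y ∈ C l, ∀ z ∈ C l, dist (G (f y)) (G (f z)) ≤ ε) := by
  classical
  -- Step 1
  obtain ⟨r0, hr00, hr01, hr0⟩ := nbhd_fact he O hO hAO 0 one_pos
  have hN0 : IsCompact (e '' ball 0 r0)ᶜ := (e_ball_open he hr01.le).isClosed_compl.isCompact
  obtain ⟨δ, hδ, hδG⟩ := Metric.uniformContinuousOn_iff.1
    (hN0.uniformContinuousOn_of_continuous (hG.mono (hr0 r0 le_rfl))) ε hε
  obtain ⟨η2, hη2, he2⟩ := Metric.uniformContinuousOn_iff.1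
    ((isCompact_closedBall (0 : Euc n) 1).uniformContinuousOn_of_continuous he.cont) (δ/4)
    (by positivity)
  -- choose r
  obtain ⟨r, hr1, hrlt, hrN⟩ := fact_N he C L hCc hCs hnull (min ((1 - r0)/2) (η2/4))
    (max (max ((1 + r0)/2) (1/2)) (1 - η2/4)) (lt_min (by linarith) (by linarith))
    (max_lt (max_lt (by linarith) (by norm_num)) (by linarith))
  have hr_a : (1 + r0)/2 < r := ((le_max_left _ _).trans (le_max_left _ _)).trans_lt hr1
  have hr_b : 1/2 < r := ((le_max_right _ _).trans (le_max_left _ _)).trans_lt hr1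
  have hr_c : 1 - η2/4 < r := (le_max_right _ _).trans_lt hr1
  obtain ⟨Ψ, hΨ⟩ := schoenflies he r (by linarith) hrlt
  have hcc : Continuous fun x : Euc n => Ψ x := Ψ.continuous.comp OnePoint.continuous_coe
  obtain ⟨η3, hη3, hΨ3⟩ := Metric.uniformContinuousOn_iff.1
    ((isCompact_closedBall (0 : Euc n) 2).uniformContinuousOn_of_continuous hcc.continuousOn) (δ/4)
    (by positivity)
  obtain ⟨m0, hm0⟩ := exists_nat_gt (4/η3)
  set m := m0 + 1
  have hmpos : 0 < (m : ℝ) := by positivity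
  have hm : 4 / (m:ℝ) < η3 := by
    rw [div_lt_iff₀ hmpos]
    rw [div_lt_iff₀ hη3] at hm0
    have : (m:ℝ) = m0 + 1 := by simp [m]
    rw [this]; nlinarith
  set δ3 := η3 / 32 with hδ3
  -- knots
  obtain ⟨k, k0, km, hk⟩ := knots (fun s s' => ∀ l ∈ L, ∀ x, ‖x‖ ≤ 1 → e x ∈ C l → s' ≤ ‖x‖ →
      (∀ y, ‖y‖ ≤ 1 → e y ∈ C l → s < ‖y‖) ∧
      ∀ y z, ‖y‖ ≤ 1 → ‖z‖ ≤ 1 → e y ∈ C l → e z ∈ C l → dist y z < δ3)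
    (by
      intro s hs
      obtain ⟨s', h1, h2, h3⟩ := fact_N he C L hCc hCs hnull (min ((1 - s)/2) δ3) ((1+s)/2)
        (lt_min (by linarith) (by positivity)) (by linarith)
      refine ⟨s', by linarith, h2, ?_⟩
      intro l hl x hx hxC hsx
      refine ⟨fun y hy hyC => ?_, fun y z hy hz hyC hzC =>
        (h3 l hl x hx hxC hsx y z hy hz hyC hzC).trans_le (min_le_right _ _)⟩
      have h4 := (h3 l hl x hx hxC hsx x y hx hy hxC hyC).trans_le (min_le_left _ _)
      have h5 : ‖x‖ - ‖y‖ ≤ dist x y := by rw [dist_eq_norm]; exact norm_sub_norm_le _ _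
      linarith)
    (by
      intro s l hl x hx hxC h1x
      exfalso
      have := hCs l hl hxC
      rw [e_mem_ball_iff he hx le_rfl] at this
      linarith)
    r hrlt m (by simp [m])
  obtain ⟨g, g1, g2, -⟩ := pl_iso k (fun _ => 1/(m:ℝ)) m (fun i hi => (hk i hi).1)
    (fun i hi => by positivity)
  rw [k0] at g1 g2
  have g2' : ∀ j ≤ m, g (k j) = r + j / (m:ℝ) := by
    intro j hj
    rw [g2 j hj]; simp [div_eq_mul_inv]
  have gz : g 0 = 0 := g1 0 (by linarith)
  have gtop : g 1 = r + 1 := by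
    have := g2' m le_rfl
    rw [km] at this; rw [this]; field_simp
  have gr : g r = r := g1 r le_rfl
  set Λ := radial n g gz
  have hΛn : ∀ x, ‖Λ x‖ = g ‖x‖ := norm_radial g gz
  have hΛid : ∀ x, ‖x‖ ≤ r → Λ x = x := fun x hx => radial_of_eq _ _ _ (g1 _ hx)
  have hΛ2 : ∀ x, ‖x‖ ≤ 1 → Λ x ∈ closedBall (0 : Euc n) 2 := by
    intro x hx
    rw [mem_closedBall_zero_iff, hΛn]
    have := g.monotone hx
    linarith
  let f : Sph n → Sph n := fun y => if y ∈ e '' closedBall 0 1 then Ψ (Λ (einv e y) : Euc n) else y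
  have hf : ∀ x, ‖x‖ ≤ 1 → f (e x) = Ψ (Λ x : Euc n) := by
    intro x hx
    simp only [f]
    rw [if_pos ⟨x, by simpa using hx, rfl⟩, einv_e he hx]
  obtain ⟨e', he', hee⟩ := ext_ball Ψ ((r + 1)/2) (by linarith)
  have hball : ∀ x : Euc n, Ψ x ∈ e '' ball 0 r ↔ ‖x‖ < r := by
    intro x
    constructor
    · rintro ⟨y, hy, hyx⟩
      have hy' : ‖y‖ < r := by simpa using hy
      rw [← hΨ y hy'.le] at hyx
      rwa [← OnePoint.coe_injective (Ψ.injective hyx)]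
    · intro hx; exact ⟨x, by simpa using hx, (hΨ x hx.le).symm⟩
  refine ⟨(e '' ball 0 r)ᶜ, f, e', (e_ball_open he hrlt.le).isClosed_compl, hr0 r (by linarith),
    compl_subset_compl.2 (image_mono (ball_subset_ball hrlt.le)), ?_, ?_, ?_, ?_, he', ?_, ?_, ?_⟩
  · have : ContinuousOn (fun y => Ψ (Λ (einv e y) : Euc n)) (e '' closedBall 0 1) :=
      (hcc.comp Λ.continuous).comp_continuousOn (einv_cont he)
    exact this.congr fun y hy => if_pos hy
  · rintro _ ⟨x, hx, rfl⟩ _ ⟨y, hy, rfl⟩ hxy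
    rw [hf x (by simpa using hx), hf y (by simpa using hy)] at hxy
    rw [Λ.injective (OnePoint.coe_injective (Ψ.injective hxy))]
  · intro y hy
    rw [mem_compl_iff, not_not] at hy
    obtain ⟨x, hx, rfl⟩ := hy
    have hx' : ‖x‖ < r := by simpa using hx
    rw [hf x (by linarith), hΛid x hx'.le, hΨ x hx'.le]
  · rintro y hy ⟨x, hx, rfl⟩
    have hx' : ‖x‖ ≤ 1 := by simpa using hx
    rw [mem_compl_iff, e_mem_ball_iff he hx' hrlt.le] at hy
    rw [mem_compl_iff, hf x hx', hball, hΛn, ← gr, g.lt_iff_lt]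
    exact hy
  · rintro y ⟨x, hx, rfl⟩ hy
    have hx' : ‖x‖ ≤ 1 := by simpa using hx
    have h2 := hee ((r+1)/(2*r)) (by have : 0 < r := by linarith
                                     positivity)
    have h3 : (r + 1) / 2 / ((r + 1) / (2 * r)) = r := by
      have : r + 1 ≠ 0 := by linarith
      have : r ≠ 0 := by linarith
      field_simp
    rw [h3] at h2
    have h4 : e' x ∈ Set.image e' (ball 0 ((r+1)/(2*r))) := by
      refine ⟨x, ?_, rfl⟩
      rw [mem_ball_zero_iff]
      refine hx'.trans_lt ?_
      rw [lt_div_iff₀ (by linarith)]; linarith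
    rw [h2] at h4
    apply h4
    obtain ⟨z, hz, hzx⟩ := hy
    have hz' : ‖z‖ < r := by simpa using hz
    exact ⟨z, by simpa using hz'.le, by rw [← hzx]; exact hΨ z hz'.le⟩
  · rw [hee (1/2) (by norm_num), compl_compl]
    have h3 : (r + 1) / 2 / (1/2) = r + 1 := by ring
    rw [h3]
    ext y
    constructor
    · rintro ⟨_, ⟨x, hx, rfl⟩, rfl⟩
      have hx' : ‖x‖ ≤ 1 := by simpa using hx
      refine ⟨Λ x, ?_, (hf x hx').symm⟩
      rw [mem_closedBall_zero_iff, hΛn, ← gtop, g.le_iff_le]; exact hx'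
    · rintro ⟨z, hz, rfl⟩
      have hx' : ‖Λ.symm z‖ ≤ 1 := by
        rw [← g.le_iff_le, ← hΛn, Λ.apply_symm_apply, gtop]; simpa using hz
      refine ⟨_, ⟨Λ.symm z, by simpa using hx', rfl⟩, ?_⟩
      rw [hf _ hx', Λ.apply_symm_apply]
  · intro l hl
    by_cases hmeet : ∃ x, ‖x‖ ≤ 1 ∧ e x ∈ C l ∧ r ≤ ‖x‖
    swap
    · left
      intro y hy
      obtain ⟨x, hx, rfl⟩ := hCs l hl hy
      have hx' : ‖x‖ < 1 := by simpa using hx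
      have hxr : ‖x‖ ≤ r := by
        by_contra h
        exact hmeet ⟨x, hx'.le, hy, (not_le.1 h).le⟩
      rw [hf x hx'.le, hΛid x hxr, hΨ x hxr]
    · right
      obtain ⟨x0, hx0, hx0C, hx0r⟩ := hmeet
      have hdiam := hrN l hl x0 hx0 hx0C hx0r
      have hlow : ∀ x, ‖x‖ ≤ 1 → e x ∈ C l → r0 ≤ ‖x‖ := by
        intro x hx hxC
        have h4 := (hdiam x0 x hx0 hx hx0C hxC).trans_le (min_le_left _ _)
        have h5 : ‖x0‖ - ‖x‖ ≤ dist x0 x := by rw [dist_eq_norm]; exact norm_sub_norm_le _ _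
        linarith
      have hfN : ∀ x, ‖x‖ ≤ 1 → e x ∈ C l → f (e x) ∈ (e '' ball 0 r0)ᶜ := by
        intro x hx hxC
        rw [hf x hx]
        rintro ⟨z, hz, hzx⟩
        have hz' : ‖z‖ < r0 := by simpa using hz
        rw [← hΨ z (by linarith)] at hzx
        have h6 := OnePoint.coe_injective (Ψ.injective hzx)
        have h7 := hΛn x
        rw [← h6] at h7
        have h8 := g.monotone (hlow x hx hxC)
        rw [g1 r0 (by linarith)] at h8
        linarith
      have hrep : ∀ y ∈ C l, ∃ x, ‖x‖ ≤ 1 ∧ e x = y := by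
        intro y hy
        obtain ⟨x, hx, rfl⟩ := hCs l hl hy
        exact ⟨x, (mem_ball_zero_iff.1 hx).le, rfl⟩
      have key : ∀ x z, ‖x‖ ≤ 1 → ‖z‖ ≤ 1 → e x ∈ C l → e z ∈ C l → dist (f (e x)) (f (e z)) < δ := by
        by_cases hk1 : ∃ x, ‖x‖ ≤ 1 ∧ e x ∈ C l ∧ k 1 ≤ ‖x‖
        · -- case (ii)
          obtain ⟨x1, hx1, hx1C, hx1k⟩ := hk1
          obtain ⟨hgt, hsmall⟩ := (hk 0 (by simp [m])).2 l hl x1 hx1 hx1C hx1k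
          rw [k0] at hgt
          -- one-sided estimate of radii
          have hone : ∀ x z, ‖x‖ ≤ 1 → ‖z‖ ≤ 1 → e x ∈ C l → e z ∈ C l →
              g ‖z‖ ≤ g ‖x‖ + 2 / m := by
            intro x z hx hz hxC hzC
            have hex : ∃ i, i ≤ m ∧ ‖x‖ ≤ k i := ⟨m, le_rfl, by rw [km]; exact hx⟩
            have hi := Nat.find_spec hex
            set i := Nat.find hex with hidef
            have hi0 : i ≠ 0 := by
              intro h; rw [h, k0] at hi; linarith [hi.2, hgt x hx hxC]
            obtain ⟨j, hj⟩ := Nat.exists_eq_succ_of_ne_zero hi0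
            have hjm : j < m := by omega
            have hjx : k j < ‖x‖ := by
              by_contra hcon
              exact Nat.find_min hex (show j < Nat.find hex by omega) ⟨hjm.le, not_lt.1 hcon⟩
            have hgx : r + j / (m:ℝ) ≤ g ‖x‖ := by
              rw [← g2' j hjm.le]; exact g.monotone hjx.le
            have hgz : g ‖z‖ ≤ r + (j + 2) / (m:ℝ) := by
              rcases Nat.lt_or_ge i m with him | him
              · have : ‖z‖ ≤ k (i+1) := by
                  by_contra hcon
                  have := ((hk i him).2 l hl z hz hzC (not_le.1 hcon).le).1 x hx hxC
                  linarith [hi.2]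
                have h9 := g.monotone this
                rw [g2' (i+1) (by omega), hj] at h9
                push_cast at h9
                have e9 : ((j:ℝ) + 1 + 1) = j + 2 := by ring
                rw [e9] at h9; exact h9
              · have h9 := g.monotone hz
                rw [gtop] at h9
                have : (1:ℝ) ≤ (j + 2)/(m:ℝ) := by
                  rw [le_div_iff₀ hmpos]
                  have : m ≤ j + 1 := by omega
                  have : (m:ℝ) ≤ j + 1 := by exact_mod_cast this
                  linarith
                linarith
            have : (j + 2) / (m:ℝ) = j / m + 2 / m := by ring
            linarith
          intro x z hx hz hxC hzC
          rw [hf x hx, hf z hz]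
          have hb : dist (Λ x) (Λ z) < η3 := by
            have h1 := hone x z hx hz hxC hzC
            have h2 := hone z x hz hx hzC hxC
            have hxr := hgt x hx hxC
            have hzr := hgt z hz hzC
            have h3 := dist_dir (g ‖x‖) (g ‖z‖) x z
              (by rw [← gz]; exact g.monotone (norm_nonneg z))
              (by have := g.monotone hz; linarith)
              (by rintro rfl; rw [norm_zero] at hxr; linarith) (by linarith)
            have h4 := hsmall x z hx hz hxC hzC
            have h5 : |g ‖x‖ - g ‖z‖| ≤ 2 / m := by
              rw [abs_le]; constructor <;> linarith
            have h6 : 4 / (m:ℝ) = 2 * (2 / m) := by ring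
            calc dist (Λ x) (Λ z) ≤ _ := h3
              _ < η3 := by rw [h6] at hm; linarith
          have := hΨ3 _ (hΛ2 x hx) _ (hΛ2 z hz) hb
          linarith
        · -- case (i)
          have hlt : ∀ x, ‖x‖ ≤ 1 → e x ∈ C l → ‖x‖ < k 1 := by
            intro x hx hxC
            by_contra h
            exact hk1 ⟨x, hx, hxC, not_lt.1 h⟩
          have hhat : ∀ x, ‖x‖ ≤ 1 → e x ∈ C l → ∃ x', ‖x'‖ ≤ 1 ∧ dist x' x ≤ 1 - r ∧
              dist (f (e x)) (e x') < δ/4 := by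
            intro x hx hxC
            rcases le_or_gt ‖x‖ r with h | h
            · refine ⟨x, hx, by rw [dist_self]; linarith, ?_⟩
              rw [hf x hx, hΛid x h, hΨ x h, dist_self]; positivity
            · have hxp : 0 < ‖x‖ := by linarith
              have hn : ‖(r / ‖x‖) • x‖ = r := by
                rw [norm_smul, Real.norm_of_nonneg (by positivity)]; field_simp
              refine ⟨(r / ‖x‖) • x, by rw [hn]; exact hrlt.le, ?_, ?_⟩
              · have : (r / ‖x‖) • x - x = ((r - ‖x‖)/‖x‖) • x := by
                  rw [sub_div, sub_smul, div_self hxp.ne', one_smul]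
                rw [dist_eq_norm, this, norm_smul, norm_div, norm_norm, Real.norm_eq_abs,
                  abs_of_nonpos (by linarith)]
                field_simp; linarith
              · rw [← hΨ _ hn.le, hf x hx]
                apply hΨ3 _ (hΛ2 x hx)
                · rw [mem_closedBall_zero_iff, hn]; linarith
                · have : Λ x - (r / ‖x‖) • x = ((g ‖x‖ - r)/‖x‖) • x := by
                    rw [sub_div, sub_smul]; rfl
                  have h1 : r ≤ g ‖x‖ := by have := g.monotone h.le; rwa [gr] at this
                  have h2 := g.monotone (hlt x hx hxC).le
                  rw [g2' 1 (by simp [m])] at h2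
                  rw [dist_eq_norm, this, norm_smul, norm_div, norm_norm, Real.norm_eq_abs,
                    abs_of_nonneg (by linarith)]
                  have h3 : (g ‖x‖ - r) / ‖x‖ * ‖x‖ = g ‖x‖ - r := by field_simp
                  rw [h3]
                  push_cast at h2
                  have h6 : 4 / (m:ℝ) = 4 * (1 / m) := by ring
                  have h7 : 0 < 1 / (m:ℝ) := by positivity
                  linarith
          intro x z hx hz hxC hzC
          obtain ⟨x', a1, a2, a3⟩ := hhat x hx hxC
          obtain ⟨z', b1, b2, b3⟩ := hhat z hz hzC
          have h1 := (hdiam x z hx hz hxC hzC).trans_le (min_le_right _ _)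
          have h2 : dist x' z' < η2 := by
            have := dist_triangle4 x' x z z'
            rw [dist_comm z z'] at this
            linarith
          have h3 := he2 x' (by simpa using a1) z' (by simpa using b1) h2
          have h4 := dist_triangle4 (f (e x)) (e x') (e z') (f (e z))
          rw [dist_comm (e z')] at h4
          linarith
      refine ⟨?_, ?_⟩
      · intro y hy
        obtain ⟨x, hx, rfl⟩ := hrep y hy
        exact hr0 r0 le_rfl (hfN x hx hy)
      · intro y hy z hz
        obtain ⟨x, hx, rfl⟩ := hrep y hy
        obtain ⟨w, hw, rfl⟩ := hrep z hz
        exact (hδG _ (hfN x hx hy) _ (hfN w hw hz) (key x w hx hw hy hz)).le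

end

lemma limit_lemma {S : Type*} [MetricSpace S] [CompactSpace S] (D : ℕ → Set S)
    (hDc : ∀ m, IsClosed (D m)) (hDa : ∀ m, D (m+1) ⊆ D m) (F f : ℕ → S → S)
    (hFf : ∀ m x, F (m+1) x = F m (f m x)) (hmap : ∀ m, MapsTo (f m) (D (m+1)) (D m))
    (hFc : ∀ m, ContinuousOn (F m) (D m)) (hFi : ∀ m, InjOn (F m) (D m)) (c : ℝ) (hc : 0 < c)
    (hd1 : ∀ m, ∀ x ∈ D (m+1), dist (f m x) x ≤ c / 2 / 2^m)
    (hd2 : ∀ m, ∀ x ∈ D (m+1), dist (F m (f m x)) (F m x) ≤ c / 2 / 2^m) :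
    ∃ h : S → S, ContinuousOn h (⋂ m, D m) ∧ InjOn h (⋂ m, D m) ∧
      h '' (⋂ m, D m) = ⋂ m, F m '' D m := by
  have hanti : Antitone D := antitone_nat_of_succ_le hDa
  have hb : Tendsto (fun m : ℕ => c / 2 ^ m) atTop (𝓝 0) := by
    have := (tendsto_pow_atTop_nhds_zero_of_lt_one (by norm_num : (0:ℝ) ≤ 1/2) (by norm_num)).const_mul c
    simpa [div_eq_mul_inv] using this
  -- images decreasing
  have himg : ∀ m, F (m+1) '' D (m+1) ⊆ F m '' D m := by
    rintro m _ ⟨x, hx, rfl⟩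
    exact ⟨f m x, hmap m hx, (hFf m x).symm⟩
  have hianti : Antitone fun m => F m '' D m := antitone_nat_of_succ_le himg
  have hicl : ∀ m, IsClosed (F m '' D m) := fun m =>
    ((hDc m).isCompact.image_of_continuousOn (hFc m)).isClosed
  -- estimates for F
  have hFd : ∀ m l, m ≤ l → ∀ x ∈ D l, dist (F l x) (F m x) ≤ c / 2^m - c / 2^l := by
    intro m l hml
    induction l, hml using Nat.le_induction with
    | base => intro x _; simp
    | succ l hml ih =>
      intro x hx
      have h1 := ih x (hDa l hx)
      have h2 := hd2 l x hx
      rw [← hFf] at h2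
      have h3 := dist_triangle (F (l+1) x) (F l x) (F m x)
      have h4 : c / 2 / 2^l = c / 2^l - c / 2^(l+1) := by rw [pow_succ]; field_simp; ring
      linarith
  have hFd' : ∀ m l, m ≤ l → ∀ x ∈ D l, dist (F l x) (F m x) ≤ c / 2^m := by
    intro m l hml x hx
    have := hFd m l hml x hx
    have : 0 ≤ c / 2^l := by positivity
    linarith
  have hex : ∀ x, ∃ y, x ∈ (⋂ m, D m) → Tendsto (fun m => F m x) atTop (𝓝 y) := by
    intro x
    by_cases hx : x ∈ ⋂ m, D m
    · rw [mem_iInter] at hx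
      have : CauchySeq fun m => F m x := by
        apply cauchySeq_of_le_tendsto_0' (fun m => c / 2^m) _ hb
        intro m l hml
        rw [dist_comm]; exact hFd' m l hml x (hx l)
      obtain ⟨y, hy⟩ := cauchySeq_tendsto_of_complete this
      exact ⟨y, fun _ => hy⟩
    · exact ⟨x, fun h => absurd h hx⟩
  choose h hh using hex
  have hunif : ∀ m, ∀ x ∈ ⋂ m, D m, dist (h x) (F m x) ≤ c / 2^m := by
    intro m x hx
    apply le_of_tendsto ((hh x hx).dist tendsto_const_nhds)
    filter_upwards [eventually_ge_atTop m] with l hl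
    exact hFd' m l hl x (mem_iInter.1 hx l)
  have hsub : ∀ x ∈ ⋂ m, D m, ∀ m, h x ∈ F m '' D m := by
    intro x hx m
    apply (hicl m).mem_of_tendsto (hh x hx)
    filter_upwards [eventually_ge_atTop m] with l hl
    exact hianti hl ⟨x, mem_iInter.1 hx l, rfl⟩
  -- pulled back points
  have hG : ∀ m l, m ≤ l → ∃ g : S → S, MapsTo g (D l) (D m) ∧ (∀ x, F l x = F m (g x)) ∧
      ∀ x ∈ D l, dist (g x) x ≤ c / 2^m - c / 2^l := by
    intro m l hml
    induction l, hml using Nat.le_induction with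
    | base => exact ⟨id, fun x hx => hx, fun x => rfl, fun x _ => by simp⟩
    | succ l hml ih =>
      obtain ⟨g, g1, g2, g3⟩ := ih
      refine ⟨g ∘ f l, fun x hx => g1 (hmap l hx), fun x => by rw [hFf, g2]; rfl, ?_⟩
      intro x hx
      have h1 := g3 _ (hmap l hx)
      have h2 := hd1 l x hx
      have h3 := dist_triangle (g (f l x)) (f l x) x
      have h4 : c / 2 / 2^l = c / 2^l - c / 2^(l+1) := by rw [pow_succ]; field_simp; ring
      simp only [Function.comp]
      linarith
  have hp : ∀ m, ∀ x ∈ ⋂ m, D m, ∀ p ∈ D m, F m p = h x → dist p x ≤ c / 2^m := by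
    intro m x hx p hpD hpx
    have hK := (hDc m).isCompact
    classical
    let inv : S → S := fun y => if hy : ∃ z ∈ D m, F m z = y then hy.choose else y
    have hinv : ∀ z ∈ D m, inv (F m z) = z := by
      intro z hz
      have hy : ∃ z' ∈ D m, F m z' = F m z := ⟨z, hz, rfl⟩
      simp only [inv, dif_pos hy]
      exact hFi m hy.choose_spec.1 hz hy.choose_spec.2
    have hic := contOn_inv_of_compact hK (hFc m) inv hinv
    have h1 : Tendsto (fun l => inv (F l x)) atTop (𝓝 (inv (h x))) := by
      have h2 := hic (h x) (hsub x hx m)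
      apply h2.tendsto.comp
      rw [tendsto_nhdsWithin_iff]
      refine ⟨hh x hx, ?_⟩
      filter_upwards [eventually_ge_atTop m] with l hl
      exact hianti hl ⟨x, mem_iInter.1 hx l, rfl⟩
    rw [← hpx, hinv p hpD] at h1
    apply le_of_tendsto (h1.dist tendsto_const_nhds)
    filter_upwards [eventually_ge_atTop m] with l hl
    obtain ⟨g, g1, g2, g3⟩ := hG m l hl
    have hxl := mem_iInter.1 hx l
    rw [g2, hinv _ (g1 hxl)]
    have := g3 x hxl
    have : 0 ≤ c / 2^l := by positivity
    linarith
  refine ⟨h, ?_, ?_, ?_⟩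
  · have : TendstoUniformlyOn F h atTop (⋂ m, D m) := by
      rw [Metric.tendstoUniformlyOn_iff]
      intro ε hε
      filter_upwards [hb.eventually (gt_mem_nhds hε)] with m hm x hx
      exact (hunif m x hx).trans_lt hm
    exact this.continuousOn (Frequently.of_forall fun m => (hFc m).mono (iInter_subset _ m))
  · intro x hx y hy hxy
    by_contra hne
    have hd : 0 < dist x y := dist_pos.2 hne
    obtain ⟨m, hm⟩ := (hb.eventually (gt_mem_nhds (half_pos hd))).exists
    obtain ⟨p, hpD, hpx⟩ := hsub x hx m
    have h1 := hp m x hx p hpD hpx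
    have h2 := hp m y hy p hpD (hpx.trans hxy)
    have := dist_triangle_left x y p
    linarith
  · apply Subset.antisymm
    · rintro _ ⟨x, hx, rfl⟩
      exact mem_iInter.2 (hsub x hx)
    · intro y hy
      rw [mem_iInter] at hy
      choose p hpD hpy using hy
      have hpp : ∀ m, p m = f m (p (m+1)) := by
        intro m
        apply hFi m (hpD m) (hmap m (hpD (m+1)))
        rw [hpy, ← hFf, hpy]
      have hcau : CauchySeq p := by
        apply cauchySeq_of_le_geometric_two (C := c)
        intro m
        have := hd1 m _ (hpD (m+1))
        rwa [← hpp] at this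
      obtain ⟨x, hx⟩ := cauchySeq_tendsto_of_complete hcau
      have hxD : ∀ m, x ∈ D m := by
        intro m
        apply (hDc m).mem_of_tendsto hx
        filter_upwards [eventually_ge_atTop m] with l hl
        exact hanti hl (hpD l)
      have hxX : x ∈ ⋂ m, D m := mem_iInter.2 hxD
      refine ⟨x, hxX, ?_⟩
      have hest : ∀ m, dist (F m x) y ≤ c / 2^m := by
        intro m
        have h1 : Tendsto (fun l => F m (p l)) atTop (𝓝 (F m x)) := by
          apply (hFc m x (hxD m)).tendsto.comp
          rw [tendsto_nhdsWithin_iff]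
          refine ⟨hx, ?_⟩
          filter_upwards [eventually_ge_atTop m] with l hl
          exact hanti hl (hpD l)
        apply le_of_tendsto (h1.dist tendsto_const_nhds)
        filter_upwards [eventually_ge_atTop m] with l hl
        have := hFd' m l hl _ (hpD l)
        rw [hpy] at this
        rwa [dist_comm]
      have h2 : Tendsto (fun m => F m x) atTop (𝓝 y) := by
        rw [tendsto_iff_dist_tendsto_zero]
        exact squeeze_zero (fun _ => dist_nonneg) hest hb
      exact tendsto_nhds_unique (hh x hxX) h2

section
variable {n : ℕ}

def capA (e : ℕ → Euc n → Sph n) (i : ℕ) : Set (Sph n) := (e i '' ball 0 1)ᶜ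

def Dom (e : ℕ → Euc n → Sph n) (T : Finset ℕ) : Set (Sph n) :=
  {y | ∀ i ∈ T, y ∈ e i '' closedBall 0 1}

structure Sys (e : ℕ → Euc n → Sph n) : Prop where
  emb : ∀ i, EmbB (e i)
  dj : ∀ i j, i ≠ j → Disjoint (capA e i) (capA e j)
  null : ∀ δ > 0, {i | δ ≤ diam (capA e i)}.Finite

structure St (e : ℕ → Euc n → Sph n) (T : Finset ℕ) (F : Sph n → Sph n)
    (e' : ℕ → Euc n → Sph n) (β : ℝ) : Prop where
  cont : ContinuousOn F (Dom e T)
  inj : InjOn F (Dom e T)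
  emb : ∀ i ∈ T, EmbB (e' i)
  img : F '' Dom e T = (⋃ i ∈ T, e' i '' ball 0 (1/2))ᶜ
  dj : ∀ i ∈ T, ∀ j ∈ T, i ≠ j → Disjoint (e' i '' ball 0 (1/2)) (e' j '' ball 0 (1/2))
  small : ∀ l ∉ T, ∀ y ∈ capA e l, ∀ z ∈ capA e l, dist y z < β ∧ dist (F y) (F z) < β

variable {e : ℕ → Euc n → Sph n}

lemma capA_closed (h : Sys e) (i : ℕ) : IsClosed (capA e i) :=
  (e_ball_open (h.emb i) le_rfl).isClosed_compl

lemma Dom_closed (h : Sys e) (T : Finset ℕ) : IsClosed (Dom e T) := by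
  have : Dom e T = ⋂ i ∈ T, e i '' closedBall 0 1 := by
    ext y; simp only [Dom, mem_iInter]; rfl
  rw [this]
  exact isClosed_biInter fun i _ =>
    ((isCompact_closedBall _ _).image_of_continuousOn (h.emb i).cont).isClosed

lemma not_capA (i : ℕ) {y : Sph n} (hy : y ∉ capA e i) : y ∈ e i '' ball 0 1 := by
  simpa [capA] using hy

lemma capA_sub_ball (h : Sys e) {i j : ℕ} (hij : i ≠ j) : capA e i ⊆ e j '' ball 0 1 := by
  intro y hy
  exact not_capA j fun hy' => (h.dj i j hij).le_bot ⟨hy, hy'⟩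

lemma capA_sub_Dom (h : Sys e) {T : Finset ℕ} {l : ℕ} (hl : l ∉ T) : capA e l ⊆ Dom e T := by
  intro y hy i hi
  exact image_mono ball_subset_closedBall (capA_sub_ball h (by rintro rfl; exact hl hi) hy)

lemma exists_O (h : Sys e) (T J : Finset ℕ) (F : Sph n → Sph n) (hF : ContinuousOn F (Dom e T))
    (hJ : Disjoint J T) (β : ℝ)
    (hsm : ∀ l ∉ T, ∀ y ∈ capA e l, ∀ z ∈ capA e l, dist y z < β ∧ dist (F y) (F z) < β) :
    ∃ O : ℕ → Set (Sph n), (∀ j ∈ J, IsOpen (O j) ∧ capA e j ⊆ O j ∧ O j ⊆ Dom e T ∧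
      ∀ y ∈ O j, ∀ z ∈ O j, dist y z < β ∧ dist (F y) (F z) < β) ∧
      ∀ i ∈ J, ∀ j ∈ J, i ≠ j → Disjoint (O i) (O j) := by
  -- pairwise separation
  have hsep : ∀ i j, ∃ u v : Set (Sph n), i ≠ j → IsOpen u ∧ IsOpen v ∧ capA e i ⊆ u ∧ capA e j ⊆ v ∧
      Disjoint u v := by
    intro i j
    by_cases hij : i = j
    · exact ⟨∅, ∅, fun h => absurd hij h⟩
    · obtain ⟨u, v, h1⟩ := SeparatedNhds.of_isCompact_isCompact (capA_closed h i).isCompact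
        (capA_closed h j).isCompact (h.dj i j hij)
      exact ⟨u, v, fun _ => h1⟩
  choose u v huv using hsep
  -- interior of the domain
  let I : Set (Sph n) := ⋂ i ∈ T, e i '' ball 0 1
  have hIo : IsOpen I := isOpen_biInter_finset fun i _ => e_ball_open (h.emb i) le_rfl
  have hID : I ⊆ Dom e T := by
    intro y hy i hi
    exact image_mono ball_subset_closedBall (mem_iInter₂.1 hy i hi)
  have hsz : ∀ j, ∃ w : Set (Sph n), j ∈ J → IsOpen w ∧ capA e j ⊆ w ∧ w ⊆ I ∧
      ∀ y ∈ w, ∀ z ∈ w, dist y z < β ∧ dist (F y) (F z) < β := by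
    intro j
    by_cases hj : j ∈ J
    swap
    · exact ⟨∅, fun h => absurd h hj⟩
    have hjT : j ∉ T := Finset.disjoint_left.1 hJ hj
    have hjI : capA e j ⊆ I := by
      intro y hy
      exact mem_iInter₂.2 fun i hi => capA_sub_ball h (by rintro rfl; exact hjT hi) hy
    have hFI : ContinuousOn F I := hF.mono hID
    have ho : IsOpen ((I ×ˢ I) ∩ (fun p : Sph n × Sph n => (dist p.1 p.2, dist (F p.1) (F p.2))) ⁻¹'
        (Iio β ×ˢ Iio β)) := by
      apply ContinuousOn.isOpen_inter_preimage _ (hIo.prod hIo) (isOpen_Iio.prod isOpen_Iio)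
      apply ContinuousOn.prodMk
      · exact (continuous_fst.dist continuous_snd).continuousOn
      · have c1 : ContinuousOn (fun p : Sph n × Sph n => F p.1) (I ×ˢ I) :=
          hFI.comp continuousOn_fst (fun p hp => hp.1)
        have c2 : ContinuousOn (fun p : Sph n × Sph n => F p.2) (I ×ˢ I) :=
          hFI.comp continuousOn_snd (fun p hp => hp.2)
        exact continuous_dist.comp_continuousOn (ContinuousOn.prodMk c1 c2)
    obtain ⟨a, b, ha, hb, hja, hjb, hab⟩ := generalized_tube_lemma (capA_closed h j).isCompact
      (capA_closed h j).isCompact ho (by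
        rintro ⟨y, z⟩ ⟨hy, hz⟩
        exact ⟨⟨hjI hy, hjI hz⟩, hsm j hjT y hy z hz⟩)
    refine ⟨a ∩ b ∩ I, fun _ => ⟨(ha.inter hb).inter hIo, fun y hy => ⟨⟨hja hy, hjb hy⟩, hjI hy⟩,
      inter_subset_right, ?_⟩⟩
    intro y hy z hz
    exact (hab (show (y, z) ∈ a ×ˢ b from ⟨hy.1.1, hz.1.2⟩)).2
  choose w hw using hsz
  refine ⟨fun j => w j ∩ ⋂ i ∈ J.erase j, (u j i ∩ v i j), ?_, ?_⟩
  · intro j hj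
    obtain ⟨w1, w2, w3, w4⟩ := hw j hj
    refine ⟨w1.inter (isOpen_biInter_finset fun i hi => ?_), fun y hy => ⟨w2 hy, ?_⟩,
      fun y hy => hID (w3 hy.1), fun y hy z hz => w4 y hy.1 z hz.1⟩
    · have hij := Finset.ne_of_mem_erase hi
      exact (huv j i hij.symm).1.inter (huv i j hij).2.1
    · refine mem_iInter₂.2 fun i hi => ?_
      have hij := Finset.ne_of_mem_erase hi
      exact ⟨(huv j i hij.symm).2.2.1 hy, (huv i j hij).2.2.2.1 hy⟩
  · intro i hi j hj hij
    rw [Set.disjoint_left]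
    intro y hy hy'
    have h1 := (mem_iInter₂.1 hy.2 j (Finset.mem_erase.2 ⟨hij.symm, hj⟩)).1
    have h2 := (mem_iInter₂.1 hy'.2 i (Finset.mem_erase.2 ⟨hij, hi⟩)).2
    exact (Set.disjoint_left.1 (huv i j hij).2.2.2.2) h1 h2

theorem stage [Nontrivial (Euc n)] (h : Sys e) (T : Finset ℕ) (F : Sph n → Sph n)
    (e' : ℕ → Euc n → Sph n) (β β' : ℝ) (hβ : 0 < β) (hβ' : 0 < β') (hst : St e T F e' β) :
    ∃ (T' : Finset ℕ) (f : Sph n → Sph n) (e'' : ℕ → Euc n → Sph n),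
      T ⊆ T' ∧ (∀ i ∈ T, e'' i = e' i) ∧ St e T' (fun x => F (f x)) e'' β' ∧
      MapsTo f (Dom e T') (Dom e T) ∧ (∀ y ∈ Dom e T', dist (f y) y ≤ β) ∧
      (∀ y ∈ Dom e T', dist (F (f y)) (F y) ≤ β) := by
  classical
  -- the finite set of new discs
  have hJfin : {l | l ∉ T ∧ ¬ ∀ y ∈ capA e l, ∀ z ∈ capA e l,
      dist y z < β' ∧ dist (F y) (F z) < β'}.Finite := by
    obtain ⟨δ, hδ, hδF⟩ := Metric.uniformContinuousOn_iff.1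
      ((Dom_closed h T).isCompact.uniformContinuousOn_of_continuous hst.cont) β' hβ'
    apply (h.null (min δ β') (lt_min hδ hβ')).subset
    rintro l ⟨hlT, hl⟩
    by_contra hcon
    apply hl
    intro y hy z hz
    have hd : dist y z < min δ β' :=
      (dist_le_diam_of_mem (capA_closed h l).isCompact.isBounded hy hz).trans_lt (not_le.1 hcon)
    exact ⟨hd.trans_le (min_le_right _ _), hδF y (capA_sub_Dom h hlT hy) z (capA_sub_Dom h hlT hz)
      (hd.trans_le (min_le_left _ _))⟩
  set J := hJfin.toFinset
  have hJmem : ∀ l, l ∈ J ↔ l ∉ T ∧ ¬ ∀ y ∈ capA e l, ∀ z ∈ capA e l,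
      dist y z < β' ∧ dist (F y) (F z) < β' := fun l => hJfin.mem_toFinset
  have hJT : Disjoint J T := by
    rw [Finset.disjoint_left]; intro l hl; exact ((hJmem l).1 hl).1
  obtain ⟨O, hO, hOd⟩ := exists_O h T J F hst.cont hJT β hst.small
  -- apply Lemma A
  have hA : ∀ j, ∃ (N : Set (Sph n)) (f : Sph n → Sph n) (e1 : Euc n → Sph n), j ∈ J →
      IsClosed N ∧ N ⊆ O j ∧ capA e j ⊆ N ∧
      ContinuousOn f (e j '' closedBall 0 1) ∧ InjOn f (e j '' closedBall 0 1) ∧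
      (∀ y ∉ N, f y = y) ∧ (∀ y ∈ N, y ∈ e j '' closedBall 0 1 → f y ∈ N) ∧
      EmbB e1 ∧ e1 '' closedBall 0 1 ⊆ N ∧
      f '' (e j '' closedBall 0 1) = (e1 '' ball 0 (1/2))ᶜ ∧
      ∀ l ∈ {l | l ≠ j}, (∀ y ∈ capA e l, f y = y) ∨
        ((∀ y ∈ capA e l, f y ∈ O j) ∧
          ∀ y ∈ capA e l, ∀ z ∈ capA e l, dist (F (f y)) (F (f z)) ≤ β'/2) := by
    intro j
    by_cases hj : j ∈ J
    swap
    · exact ⟨∅, id, e j, fun h => absurd h hj⟩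
    obtain ⟨o1, o2, o3, -⟩ := hO j hj
    obtain ⟨N, f, e1, hh⟩ := lemmaA (h.emb j) (capA e) {l | l ≠ j} (fun l _ => capA_closed h l)
      (fun l hl => capA_sub_ball h hl) (fun δ hδ => (h.null δ hδ).subset fun l hl => hl.2)
      (O j) o1 o2 F (hst.cont.mono o3) (β'/2) (by positivity)
    exact ⟨N, f, e1, fun _ => hh⟩
  choose N fj e1 hA using hA
  have hNcl : ∀ j ∈ J, IsClosed (N j) := fun j hj => (hA j hj).1
  have hNO : ∀ j ∈ J, N j ⊆ O j := fun j hj => (hA j hj).2.1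
  have hfc : ∀ j ∈ J, ContinuousOn (fj j) (e j '' closedBall 0 1) := fun j hj => (hA j hj).2.2.2.1
  have hfi : ∀ j ∈ J, InjOn (fj j) (e j '' closedBall 0 1) := fun j hj => (hA j hj).2.2.2.2.1
  have hfid : ∀ j ∈ J, ∀ y ∉ N j, fj j y = y := fun j hj => (hA j hj).2.2.2.2.2.1
  have hfN : ∀ j ∈ J, ∀ y ∈ N j, y ∈ e j '' closedBall 0 1 → fj j y ∈ N j :=
    fun j hj => (hA j hj).2.2.2.2.2.2.1
  have hemb1 : ∀ j ∈ J, EmbB (e1 j) := fun j hj => (hA j hj).2.2.2.2.2.2.2.1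
  have he1N : ∀ j ∈ J, e1 j '' closedBall 0 1 ⊆ N j := fun j hj => (hA j hj).2.2.2.2.2.2.2.2.1
  have hfimg : ∀ j ∈ J, fj j '' (e j '' closedBall 0 1) = (e1 j '' ball 0 (1/2))ᶜ :=
    fun j hj => (hA j hj).2.2.2.2.2.2.2.2.2.1
  have halt := fun j hj => (hA j hj).2.2.2.2.2.2.2.2.2.2
  have hbb : ball (0 : Euc n) (1/2) ⊆ closedBall 0 1 :=
    (ball_subset_ball (by norm_num)).trans ball_subset_closedBall
  have hVN : ∀ j ∈ J, e1 j '' ball 0 (1/2) ⊆ N j :=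
    fun j hj => (image_mono hbb).trans (he1N j hj)
  have hND : ∀ j ∈ J, N j ⊆ Dom e T := fun j hj => (hNO j hj).trans (hO j hj).2.2.1
  have hON : ∀ i ∈ J, ∀ j ∈ J, ∀ y, y ∈ O i → y ∈ O j → i = j := by
    intro i hi j hj y hyi hyj
    by_contra hne
    exact Set.disjoint_left.1 (hOd i hi j hj hne) hyi hyj
  -- combine
  let f : Sph n → Sph n := fun y => if hy : ∃ j ∈ J, y ∈ N j then fj hy.choose y else y
  have hfO : ∀ j ∈ J, ∀ y ∈ O j, f y = fj j y := by
    intro j hj y hy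
    by_cases hyN : ∃ j ∈ J, y ∈ N j
    · simp only [f, dif_pos hyN]
      rw [hON _ hyN.choose_spec.1 j hj y (hNO _ hyN.choose_spec.1 hyN.choose_spec.2) hy]
    · simp only [f, dif_neg hyN]
      rw [hfid j hj y fun hy' => hyN ⟨j, hj, hy'⟩]
  have hfoff : ∀ y, (¬ ∃ j ∈ J, y ∈ N j) → f y = y := fun y hy => by simp only [f, dif_neg hy]
  set T' := T ∪ J
  have hD' : ∀ y ∈ Dom e T', y ∈ Dom e T := fun y hy i hi => hy i (Finset.mem_union_left _ hi)
  have hDJ : ∀ y ∈ Dom e T', ∀ j ∈ J, y ∈ e j '' closedBall 0 1 :=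
    fun y hy i hi => hy i (Finset.mem_union_right _ hi)
  have hfN' : ∀ y ∈ Dom e T', ∀ j ∈ J, y ∈ N j → f y ∈ N j := by
    intro y hy j hj hyN
    rw [hfO j hj y (hNO j hj hyN)]
    exact hfN j hj y hyN (hDJ y hy j hj)
  have hmaps : MapsTo f (Dom e T') (Dom e T) := by
    intro y hy
    by_cases hyN : ∃ j ∈ J, y ∈ N j
    · obtain ⟨j, hj, hyj⟩ := hyN
      exact hND j hj (hfN' y hy j hj hyj)
    · rw [hfoff y hyN]; exact hD' y hy
  have hfcont : ContinuousOn f (Dom e T') := by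
    intro y hy
    by_cases hyN : ∃ j ∈ J, y ∈ N j
    · obtain ⟨j, hj, hyj⟩ := hyN
      have h1 : ContinuousWithinAt (fj j) (Dom e T') y :=
        ((hfc j hj) y (hDJ y hy j hj)).mono fun z hz => hDJ z hz j hj
      apply h1.congr_of_eventuallyEq _ (hfO j hj y (hNO j hj hyj))
      filter_upwards [mem_nhdsWithin_of_mem_nhds ((hO j hj).1.mem_nhds (hNO j hj hyj))] with z hz
      exact hfO j hj z hz
    · have hcl : IsClosed (⋃ j ∈ J, N j) := isClosed_biUnion_finset hNcl
      apply continuousWithinAt_id.congr_of_eventuallyEq _ (hfoff y hyN)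
      have : (⋃ j ∈ J, N j)ᶜ ∈ 𝓝 y := hcl.isOpen_compl.mem_nhds (by
        simp only [mem_compl_iff, mem_iUnion₂]; rintro ⟨j, hj, hyj⟩; exact hyN ⟨j, hj, hyj⟩)
      filter_upwards [mem_nhdsWithin_of_mem_nhds this] with z hz
      apply hfoff
      rintro ⟨j, hj, hzj⟩
      exact hz (mem_iUnion₂.2 ⟨j, hj, hzj⟩)
  have hfinj : InjOn f (Dom e T') := by
    intro y hy z hz hyz
    by_cases hyN : ∃ j ∈ J, y ∈ N j
    · obtain ⟨j, hj, hyj⟩ := hyN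
      have h1 := hfN' y hy j hj hyj
      rw [hyz] at h1
      have hzj : z ∈ N j := by
        by_cases hzN : ∃ j ∈ J, z ∈ N j
        · obtain ⟨i, hi, hzi⟩ := hzN
          have h2 := hfN' z hz i hi hzi
          rwa [← hON i hi j hj _ (hNO i hi h2) (hNO j hj h1)]
        · rwa [hfoff z hzN] at h1
      rw [hfO j hj y (hNO j hj hyj), hfO j hj z (hNO j hj hzj)] at hyz
      exact hfi j hj (hDJ y hy j hj) (hDJ z hz j hj) hyz
    · rw [hfoff y hyN] at hyz
      by_cases hzN : ∃ j ∈ J, z ∈ N j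
      · obtain ⟨i, hi, hzi⟩ := hzN
        have h2 := hfN' z hz i hi hzi
        rw [← hyz] at h2
        exact absurd ⟨i, hi, h2⟩ hyN
      · rwa [hfoff z hzN] at hyz
  have hfimage : f '' Dom e T' = Dom e T \ ⋃ j ∈ J, e1 j '' ball 0 (1/2) := by
    apply Subset.antisymm
    · rintro _ ⟨y, hy, rfl⟩
      refine ⟨hmaps hy, ?_⟩
      intro hmem
      obtain ⟨j, hj, hyj⟩ := mem_iUnion₂.1 hmem
      have h1 := hVN j hj hyj
      have hyN : y ∈ N j := by
        by_cases hyN : ∃ j ∈ J, y ∈ N j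
        · obtain ⟨i, hi, hzi⟩ := hyN
          have h2 := hfN' y hy i hi hzi
          rwa [← hON i hi j hj _ (hNO i hi h2) (hNO j hj h1)]
        · rwa [hfoff y hyN] at h1
      rw [hfO j hj y (hNO j hj hyN)] at hyj
      have h3 : fj j y ∈ (e1 j '' ball 0 (1/2))ᶜ := by
        rw [← hfimg j hj]; exact mem_image_of_mem _ (hDJ y hy j hj)
      exact h3 hyj
    · rintro y ⟨hyD, hyV⟩
      by_cases hyN : ∃ j ∈ J, y ∈ N j
      · obtain ⟨j, hj, hyj⟩ := hyN
        have h1 : y ∈ fj j '' (e j '' closedBall 0 1) := by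
          rw [hfimg j hj]; intro h2; exact hyV (mem_iUnion₂.2 ⟨j, hj, h2⟩)
        obtain ⟨x, hx, rfl⟩ := h1
        have hxN : x ∈ N j := by
          by_contra hxN
          rw [hfid j hj x hxN] at hyj; exact hxN hyj
        refine ⟨x, ?_, hfO j hj x (hNO j hj hxN)⟩
        intro i hi
        rcases Finset.mem_union.1 hi with hi | hi
        · exact hND j hj hxN i hi
        · by_cases hij : i = j
          · rw [hij]; exact hx
          · apply image_mono ball_subset_closedBall
            apply not_capA
            intro hxi
            exact hij (hON i hi j hj x ((hO i hi).2.1 hxi) (hNO j hj hxN))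
      · refine ⟨y, ?_, hfoff y hyN⟩
        intro i hi
        rcases Finset.mem_union.1 hi with hi | hi
        · exact hyD i hi
        · apply image_mono ball_subset_closedBall
          apply not_capA
          intro hyi
          exact hyN ⟨i, hi, (hA i hi).2.2.1 hyi⟩
  let e'' : ℕ → Euc n → Sph n := fun i => if i ∈ T then e' i else fun x => F (e1 i x)
  have he''T : ∀ i ∈ T, e'' i = e' i := fun i hi => by simp [e'', hi]
  have he''J : ∀ i ∈ J, e'' i = fun x => F (e1 i x) := fun i hi => by
    have : i ∉ T := Finset.disjoint_left.1 hJT hi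
    simp [e'', this]
  have he''Jb : ∀ i ∈ J, e'' i '' ball 0 (1/2) = F '' (e1 i '' ball 0 (1/2)) := fun i hi => by
    rw [he''J i hi, image_image]
  have hVD : ∀ j ∈ J, e1 j '' ball 0 (1/2) ⊆ Dom e T := fun j hj => (hVN j hj).trans (hND j hj)
  have hJT' : ∀ i ∈ T, ∀ j ∈ J, Disjoint (e'' i '' ball 0 (1/2)) (e'' j '' ball 0 (1/2)) := by
    intro i hi j hj
    rw [he''Jb j hj, he''T i hi, Set.disjoint_left]
    intro y hy hy'
    have h1 : y ∈ F '' Dom e T := image_mono (hVD j hj) hy'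
    rw [hst.img] at h1
    exact h1 (mem_iUnion₂.2 ⟨i, hi, hy⟩)
  refine ⟨T', f, e'', Finset.subset_union_left, he''T, ⟨?_, ?_, ?_, ?_, ?_, ?_⟩, hmaps, ?_, ?_⟩
  · exact hst.cont.comp hfcont hmaps
  · exact hst.inj.comp hfinj hmaps
  · intro i hi
    rcases Finset.mem_union.1 hi with hi | hi
    · rw [he''T i hi]; exact hst.emb i hi
    · rw [he''J i hi]
      have hm : MapsTo (e1 i) (closedBall 0 1) (Dom e T) := fun x hx =>
        hND i hi (he1N i hi ⟨x, hx, rfl⟩)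
      exact ⟨hst.cont.comp (hemb1 i hi).cont hm, hst.inj.comp (hemb1 i hi).inj hm⟩
  · have h1 : (fun x => F (f x)) '' Dom e T' = F '' (f '' Dom e T') := by rw [image_image]
    rw [h1, hfimage, hst.inj.image_sdiff_subset (iUnion₂_subset hVD), hst.img]
    rw [image_iUnion₂]
    ext y
    simp only [Set.mem_sdiff, mem_compl_iff, mem_iUnion₂, not_exists]
    constructor
    · rintro ⟨ha, hb⟩ i hi
      rcases Finset.mem_union.1 hi with hi | hi
      · rw [he''T i hi]; exact ha i hi
      · rw [he''Jb i hi]; exact hb i hi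
    · intro hall
      constructor
      · intro i hi
        have := hall i (Finset.mem_union_left _ hi)
        rwa [he''T i hi] at this
      · intro i hi
        have := hall i (Finset.mem_union_right _ hi)
        rwa [he''Jb i hi] at this
  · intro i hi j hj hij
    rcases Finset.mem_union.1 hi with hi | hi <;> rcases Finset.mem_union.1 hj with hj | hj
    · rw [he''T i hi, he''T j hj]; exact hst.dj i hi j hj hij
    · exact hJT' i hi j hj
    · exact (hJT' j hj i hi).symm
    · rw [he''Jb i hi, he''Jb j hj, Set.disjoint_left]
      rintro _ ⟨y, hy, rfl⟩ ⟨z, hz, hzy⟩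
      have := hst.inj (hVD j hj hz) (hVD i hi hy) hzy
      rw [this] at hz
      exact hij (hON i hi j hj y (hNO i hi (hVN i hi hy)) (hNO j hj (hVN j hj hz)))
  · intro l hl y hy z hz
    have hlT : l ∉ T := fun hh => hl (Finset.mem_union_left _ hh)
    have hlJ : l ∉ J := fun hh => hl (Finset.mem_union_right _ hh)
    have hsm : ∀ y ∈ capA e l, ∀ z ∈ capA e l, dist y z < β' ∧ dist (F y) (F z) < β' := by
      by_contra hcon; exact hlJ ((hJmem l).2 ⟨hlT, hcon⟩)
    refine ⟨(hsm y hy z hz).1, ?_⟩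
    by_cases hex : ∃ j ∈ J, ∃ w ∈ capA e l, fj j w ≠ w
    · obtain ⟨j, hj, w, hw, hne⟩ := hex
      have hlj : l ≠ j := by rintro rfl; exact hlJ hj
      rcases halt j hj l hlj with h1 | ⟨h1, h2⟩
      · exact absurd (h1 w hw) hne
      · have hlO : ∀ y ∈ capA e l, y ∈ O j := by
          intro y hy
          by_cases hyN : y ∈ N j
          · exact hNO j hj hyN
          · have := h1 y hy; rwa [hfid j hj y hyN] at this
        show dist (F (f y)) (F (f z)) < β'
        rw [hfO j hj y (hlO y hy), hfO j hj z (hlO z hz)]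
        have := h2 y hy z hz
        linarith
    · push Not at hex
      have hid : ∀ y ∈ capA e l, f y = y := by
        intro y hy
        by_cases hyN : ∃ j ∈ J, y ∈ N j
        · obtain ⟨j, hj, hyj⟩ := hyN
          rw [hfO j hj y (hNO j hj hyj)]; exact hex j hj y hy
        · exact hfoff y hyN
      show dist (F (f y)) (F (f z)) < β'
      rw [hid y hy, hid z hz]; exact (hsm y hy z hz).2
  · intro y hy
    by_cases hyN : ∃ j ∈ J, y ∈ N j
    · obtain ⟨j, hj, hyj⟩ := hyN
      exact ((hO j hj).2.2.2 _ (hNO j hj (hfN' y hy j hj hyj)) _ (hNO j hj hyj)).1.le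
    · rw [hfoff y hyN, dist_self]; exact hβ.le
  · intro y hy
    by_cases hyN : ∃ j ∈ J, y ∈ N j
    · obtain ⟨j, hj, hyj⟩ := hyN
      exact ((hO j hj).2.2.2 _ (hNO j hj (hfN' y hy j hj hyj)) _ (hNO j hj hyj)).2.le
    · rw [hfoff y hyN, dist_self]; exact hβ.le

end

section
variable {n : ℕ} {e : ℕ → Euc n → Sph n}

theorem iterate_all [Nontrivial (Euc n)] (h : Sys e) :
    ∃ (g : Sph n → Sph n) (E : ℕ → Euc n → Sph n),
      ContinuousOn g {y | ∀ i, y ∈ e i '' closedBall 0 1} ∧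
      InjOn g {y | ∀ i, y ∈ e i '' closedBall 0 1} ∧
      (∀ i, EmbB (E i)) ∧
      (∀ i j, i ≠ j → Disjoint (E i '' ball 0 (1/2)) (E j '' ball 0 (1/2))) ∧
      g '' {y | ∀ i, y ∈ e i '' closedBall 0 1} = (⋃ i, E i '' ball 0 (1/2))ᶜ := by
  classical
  let β : ℕ → ℝ := fun m => 8 / 2 / 2 ^ m
  have hβ : ∀ m, 0 < β m := fun m => by positivity
  let Stt (m : ℕ) := {p : Finset ℕ × (Sph n → Sph n) × (ℕ → Euc n → Sph n) //
    St e p.1 p.2.1 p.2.2 (β m)}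
  have hstep : ∀ m (s : Stt m), ∃ (s' : Stt (m+1)) (f : Sph n → Sph n),
      s.1.1 ⊆ s'.1.1 ∧ (∀ i ∈ s.1.1, s'.1.2.2 i = s.1.2.2 i) ∧
      (∀ x, s'.1.2.1 x = s.1.2.1 (f x)) ∧ MapsTo f (Dom e s'.1.1) (Dom e s.1.1) ∧
      (∀ y ∈ Dom e s'.1.1, dist (f y) y ≤ β m) ∧
      (∀ y ∈ Dom e s'.1.1, dist (s.1.2.1 (f y)) (s.1.2.1 y) ≤ β m) := by
    intro m s
    obtain ⟨T', f, e'', h1, h2, h3, h4, h5, h6⟩ :=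
      stage h s.1.1 s.1.2.1 s.1.2.2 (β m) (β (m+1)) (hβ m) (hβ (m+1)) s.2
    exact ⟨⟨(T', fun x => s.1.2.1 (f x), e''), h3⟩, f, h1, h2, fun _ => rfl, h4, h5, h6⟩
  choose nx nf n1 n2 n3 n4 n5 n6 using hstep
  have hd2 : ∀ y z : Sph n, dist y z < β 0 := by
    intro y z
    have hy : ‖(y : Euc (n+1))‖ = 1 := by simp
    have hz : ‖(z : Euc (n+1))‖ = 1 := by simp
    have := norm_sub_le (y : Euc (n+1)) z
    have h2 : dist y z = ‖(y : Euc (n+1)) - z‖ := by rw [Subtype.dist_eq, dist_eq_norm]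
    simp only [β]; norm_num; linarith
  have hst0 : St e ∅ id e (β 0) := by
    refine ⟨continuousOn_id, injOn_id _, by simp, ?_, by simp, fun l _ y _ z _ => ⟨hd2 y z, hd2 y z⟩⟩
    have : Dom e ∅ = univ := by
      apply eq_univ_of_forall; intro y i hi; simp at hi
    rw [this]; simp
  let seq : (m : ℕ) → Stt m := fun m => Nat.rec (⟨(∅, id, e), hst0⟩ : Stt 0) (fun m s => nx m s) m
  have hseq : ∀ m, seq (m+1) = nx m (seq m) := fun m => rfl
  let T : ℕ → Finset ℕ := fun m => (seq m).1.1
  let F : ℕ → Sph n → Sph n := fun m => (seq m).1.2.1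
  let E : ℕ → ℕ → Euc n → Sph n := fun m => (seq m).1.2.2
  have hSt : ∀ m, St e (T m) (F m) (E m) (β m) := fun m => (seq m).2
  have hTm : ∀ m, T m ⊆ T (m+1) := fun m => n1 m (seq m)
  have hTmono : Monotone T := monotone_nat_of_le_succ hTm
  have hE1 : ∀ m, ∀ i ∈ T m, E (m+1) i = E m i := fun m => n2 m (seq m)
  have hE : ∀ m k, m ≤ k → ∀ i ∈ T m, E k i = E m i := by
    intro m k hmk
    induction k, hmk using Nat.le_induction with
    | base => intro i _; rfl
    | succ k hk ih => intro i hi; rw [hE1 k i (hTmono hk hi), ih i hi]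
  -- every index eventually occurs
  obtain ⟨u, hu⟩ := exists_norm_eq (Euc n) (zero_le_one (α := ℝ))
  have hex : ∀ i, ∃ m, i ∈ T m := by
    intro i
    by_contra hcon
    push Not at hcon
    have hcap : ∀ x : Euc n, ‖x‖ = 1 → e i x ∈ capA e i := by
      intro x hx hmem
      have := (e_mem_ball_iff (h.emb i) hx.le le_rfl).1 hmem
      linarith
    have hne : e i u ≠ e i (-u) := by
      intro heq
      have h1 := (h.emb i).inj (by simp [hu]) (by simp [hu]) heq
      have h3 : (2:ℝ) • u = 0 := by rw [two_smul]; nth_rewrite 1 [h1]; simp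
      have h2 : u = 0 := by simpa using h3
      rw [h2] at hu; simp at hu
    have hpos : 0 < dist (e i u) (e i (-u)) := dist_pos.2 hne
    have hb : Tendsto β atTop (𝓝 0) := by
      have := (tendsto_pow_atTop_nhds_zero_of_lt_one (by norm_num : (0:ℝ) ≤ 1/2)
        (by norm_num)).const_mul (8/2 : ℝ)
      simpa [β, div_eq_mul_inv] using this
    obtain ⟨m, hm⟩ := (hb.eventually (gt_mem_nhds hpos)).exists
    have := ((hSt m).small i (hcon m) _ (hcap u hu) _ (hcap (-u) (by simpa using hu))).1
    linarith
  choose M hM using hex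
  have hDom : (⋂ m, Dom e (T m)) = {y | ∀ i, y ∈ e i '' closedBall 0 1} := by
    ext y
    rw [mem_iInter]
    constructor
    · intro hy i; exact hy (M i) i (hM i)
    · intro hy m i _; exact hy i
  obtain ⟨g, hg1, hg2, hg3⟩ := limit_lemma (fun m => Dom e (T m)) (fun m => Dom_closed h _)
    (fun m y hy i hi => hy i (hTm m hi)) F (fun m => nf m (seq m))
    (fun m x => n3 m (seq m) x) (fun m => n4 m (seq m)) (fun m => (hSt m).cont)
    (fun m => (hSt m).inj) 8 (by norm_num) (fun m => n5 m (seq m)) (fun m => n6 m (seq m))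
  rw [hDom] at hg1 hg2 hg3
  have hEE : ∀ i m, i ∈ T m → E m i = E (M i) i := by
    intro i m hi
    rcases le_total m (M i) with hle | hle
    · exact (hE m (M i) hle i hi).symm
    · exact hE (M i) m hle i (hM i)
  refine ⟨g, fun i => E (M i) i, hg1, hg2, fun i => (hSt (M i)).emb i (hM i), ?_, ?_⟩
  · intro i j hij
    have hi := hTmono (le_max_left (M i) (M j)) (hM i)
    have hj := hTmono (le_max_right (M i) (M j)) (hM j)
    have := (hSt (max (M i) (M j))).dj i hi j hj hij
    rwa [hEE i _ hi, hEE j _ hj] at this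
  · rw [hg3]
    ext y
    rw [mem_iInter, mem_compl_iff, mem_iUnion, not_exists]
    constructor
    · intro hy i
      have := hy (M i)
      rw [(hSt (M i)).img] at this
      exact fun hyi => this (mem_iUnion₂.2 ⟨i, hM i, hyi⟩)
    · intro hy m
      rw [(hSt m).img]
      intro hcon
      obtain ⟨i, hi, hyi⟩ := mem_iUnion₂.1 hcon
      rw [hEE i m hi] at hyi
      exact hy i hyi

end

section
variable {n : ℕ}

lemma cube_ball (n : ℕ) : ∃ H : Euc n ≃ₜ Euc n,
    H '' {x : Euc n | ∀ i, x i ∈ Icc (0:ℝ) 1} = closedBall 0 1 := by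
  set s : Set (Euc n) := {x : Euc n | ∀ i, x i ∈ Icc (0:ℝ) 1} with hs
  have hcl : IsClosed s := by
    have : s = ⋂ i, (fun x : Euc n => x i) ⁻¹' Icc (0:ℝ) 1 := by
      ext x; simp [hs]
    rw [this]
    exact isClosed_iInter fun i => isClosed_Icc.preimage (by fun_prop)
  have hconv : Convex ℝ s := by
    intro x hx y hy a b ha hb hab i
    exact convex_Icc (0:ℝ) 1 (hx i) (hy i) ha hb hab
  have hne : (interior s).Nonempty := by
    have hsub : (⋂ i, (fun x : Euc n => x i) ⁻¹' Ioo (0:ℝ) 1) ⊆ s := by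
      intro x hx i
      exact Ioo_subset_Icc_self (mem_iInter.1 hx i)
    have hop : IsOpen (⋂ i, (fun x : Euc n => x i) ⁻¹' Ioo (0:ℝ) 1) :=
      isOpen_iInter_of_finite fun i => isOpen_Ioo.preimage (by fun_prop)
    refine ⟨WithLp.toLp 2 (fun _ => 1/2), interior_maximal hsub hop ?_⟩
    refine mem_iInter.2 fun i => ?_
    simp only [mem_preimage, mem_Ioo]
    norm_num
  have hb : Bornology.IsBounded s := by
    have h1 : IsCompact (Set.pi univ fun _ : Fin n => Icc (0:ℝ) 1) :=
      isCompact_univ_pi fun _ => isCompact_Icc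
    have h2 := (h1.image (PiLp.continuous_toLp 2 (fun _ : Fin n => ℝ))).isBounded
    refine h2.subset ?_
    intro x hx
    exact ⟨x.ofLp, fun i _ => hx i, rfl⟩
  obtain ⟨H, -, hH, -⟩ := exists_homeomorph_image_interior_closure_frontier_eq_unitBall hconv hne hb
  exact ⟨H, by rwa [hcl.closure_eq] at hH⟩

lemma cell_emb {A : Set (Euc (n+1))} (hA : A ⊆ Sph n) (hc : IsCell n A) :
    ∃ e : Euc n → Sph n, EmbB e ∧ e '' closedBall 0 1 = {y : Sph n | (y : Euc (n+1)) ∈ A} := by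
  obtain ⟨φ⟩ := hc
  obtain ⟨H, hH⟩ := cube_ball n
  let q : Euc n → (Fin n → Icc (0:ℝ) 1) := fun x i => projIcc 0 1 zero_le_one (H.symm x i)
  have hq : Continuous q := by
    refine continuous_pi fun i => continuous_projIcc.comp ?_
    have := H.symm.continuous
    fun_prop
  have hmem : ∀ x ∈ closedBall (0 : Euc n) 1, ∀ i, H.symm x i ∈ Icc (0:ℝ) 1 := by
    intro x hx
    rw [← hH] at hx
    obtain ⟨y, hy, rfl⟩ := hx
    simpa using hy
  let e : Euc n → Sph n := fun x => ⟨φ.symm (q x), hA (φ.symm (q x)).2⟩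
  refine ⟨e, ⟨?_, ?_⟩, ?_⟩
  · apply Continuous.continuousOn
    exact Continuous.subtype_mk (continuous_subtype_val.comp (φ.symm.continuous.comp hq)) _
  · intro x hx y hy hxy
    have h1 : ((φ.symm (q x)) : Euc (n+1)) = φ.symm (q y) := congrArg (fun z : Sph n => (z : Euc (n+1))) hxy
    have h2 : q x = q y := φ.symm.injective (Subtype.ext h1)
    apply H.symm.injective
    ext i
    have h3 := congrFun h2 i
    simp only [q] at h3
    rw [projIcc_of_mem zero_le_one (hmem x hx i), projIcc_of_mem zero_le_one (hmem y hy i)] at h3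
    exact congrArg Subtype.val h3
  · ext y
    constructor
    · rintro ⟨x, -, rfl⟩; exact (φ.symm (q x)).2
    · intro hy
      let c := φ ⟨y, hy⟩
      let z : Euc n := WithLp.toLp 2 fun i => (c i : ℝ)
      have hz : z ∈ {x : Euc n | ∀ i, x i ∈ Icc (0:ℝ) 1} := fun i => (c i).2
      refine ⟨H z, hH ▸ mem_image_of_mem _ hz, ?_⟩
      have hqz : q (H z) = c := by
        funext i
        simp only [q, H.symm_apply_apply]
        exact projIcc_val zero_le_one (c i)
      apply Subtype.ext
      simp only [e, hqz, c, φ.symm_apply_apply]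

lemma cap_sub_closure {e : Euc n → Sph n} (he : EmbB e) :
    (e '' ball 0 1)ᶜ ⊆ closure (e '' closedBall 0 1)ᶜ := by
  intro y hy
  by_cases hy1 : y ∈ e '' closedBall 0 1
  swap
  · exact subset_closure hy1
  obtain ⟨b, hb, rfl⟩ := hy1
  have hb1 : ‖b‖ ≤ 1 := by simpa using hb
  have hb2 : ¬ ‖b‖ < 1 := fun hlt => hy ((e_mem_ball_iff he hb1 le_rfl).2 hlt)
  by_contra hcon
  rw [closure_compl, mem_compl_iff, not_not] at hcon
  set V := interior (e '' closedBall 0 1)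
  obtain ⟨Ψ, hΨ, -⟩ := std_chart (e b)
  let ψ : Euc n → Sph n := fun x => Ψ (x : OnePoint (Euc n))
  have hψ : Continuous ψ := Ψ.continuous.comp OnePoint.continuous_coe
  have hψi : Function.Injective ψ := Ψ.injective.comp OnePoint.coe_injective
  have hO : IsOpen (ψ ⁻¹' V) := isOpen_interior.preimage hψ
  have hsub : ∀ x ∈ ψ ⁻¹' V, ψ x ∈ e '' closedBall 0 1 := fun x hx => interior_subset hx
  have hop := inv_dom (fun x => einv e (ψ x)) (ψ ⁻¹' V) hO
    ((einv_cont he).comp hψ.continuousOn hsub) (by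
      intro x hx y hy hxy
      apply hψi
      rw [← e_einv (hsub x hx), ← e_einv (hsub y hy)]
      exact congrArg e hxy)
  have hin : (fun x => einv e (ψ x)) '' (ψ ⁻¹' V) ⊆ closedBall 0 1 := by
    rintro _ ⟨x, hx, rfl⟩
    simpa using einv_mem (hsub x hx)
  have hbm : b ∈ (fun x => einv e (ψ x)) '' (ψ ⁻¹' V) := by
    refine ⟨0, ?_, ?_⟩
    · change Ψ _ ∈ V; rw [hΨ]; exact hcon
    · change einv e (Ψ _) = b; rw [hΨ]; exact einv_e he hb1
  have := interior_maximal hin hop hbm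
  rw [interior_closedBall _ one_ne_zero] at this
  exact hb2 (by simpa using this)

lemma frontier_half {e : Euc n → Sph n} (he : EmbB e) :
    frontier (e '' ball 0 (1/2)) = e '' sphere 0 (1/2) := by
  have hop : IsOpen (e '' ball 0 (1/2)) := e_ball_open he (by norm_num)
  have hsub : closedBall (0 : Euc n) (1/2) ⊆ closedBall 0 1 := closedBall_subset_closedBall (by norm_num)
  have hcl : closure (e '' ball 0 (1/2)) = e '' closedBall 0 (1/2) := by
    apply Subset.antisymm
    · apply closure_minimal (image_mono ball_subset_closedBall)
      exact ((isCompact_closedBall _ _).image_of_continuousOn (he.cont.mono hsub)).isClosed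
    · rw [← closure_ball (0 : Euc n) (by norm_num : (1/2:ℝ) ≠ 0)]
      apply ContinuousOn.image_closure
      rw [closure_ball (0 : Euc n) (by norm_num : (1/2:ℝ) ≠ 0)]
      exact he.cont.mono hsub
  rw [hop.frontier_eq, hcl, ← (he.inj.mono hsub).image_sdiff_subset ball_subset_closedBall,
    closedBall_sdiff_ball]

lemma comp_eq {A : Set (Euc (n+1))} (V : ℕ → Set (Sph n)) (hVo : ∀ i, IsOpen (V i))
    (hVc : ∀ i, IsPreconnected (V i)) (hVd : ∀ i j, i ≠ j → Disjoint (V i) (V j))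
    (hA : A = Subtype.val '' ⋃ i, V i) {W : Set (Euc (n+1))} (hW : W ∈ compsOf A) :
    ∃ i, W = Subtype.val '' V i := by
  obtain ⟨x, hx, rfl⟩ := hW
  have hx' := hx
  rw [hA] at hx'
  obtain ⟨x', hx'', rfl⟩ := hx'
  obtain ⟨i, hi⟩ := mem_iUnion.1 hx''
  refine ⟨i, Subset.antisymm ?_ ?_⟩
  · obtain ⟨O, hO, hOV⟩ := isOpen_induced_iff.1 (hVo i)
    obtain ⟨O', hO', hOV'⟩ := isOpen_induced_iff.1
      (isOpen_iUnion fun j => isOpen_iUnion fun _ : j ≠ i => hVo j)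
    have hsub := connectedComponentIn_subset A (x' : Euc (n+1))
    have hpre : IsPreconnected (connectedComponentIn A (x' : Euc (n+1))) :=
      isPreconnected_connectedComponentIn
    have hdis : Disjoint (V i) (⋃ j, ⋃ _ : j ≠ i, V j) := by
      simp only [disjoint_iUnion_right]
      exact fun j hj => hVd i j hj.symm
    have hmem : ∀ y : Sph n, (y : Euc (n+1)) ∈ A → y ∈ ⋃ i, V i := by
      intro y hy
      rw [hA] at hy
      obtain ⟨z, hz, hzy⟩ := hy
      rwa [← Subtype.ext hzy]
    have hS : ∀ z ∈ A, z ∈ Sph n := by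
      intro z hz
      rw [hA] at hz
      obtain ⟨y, -, rfl⟩ := hz
      exact y.2
    have hboth : connectedComponentIn A (x' : Euc (n+1)) ∩ (O ∩ O') = ∅ := by
      rw [eq_empty_iff_forall_notMem]
      rintro z ⟨hz, hzO, hzO'⟩
      have hzS := hS z (hsub hz)
      have h1 : (⟨z, hzS⟩ : Sph n) ∈ V i := by rw [← hOV]; exact hzO
      have h2 : (⟨z, hzS⟩ : Sph n) ∈ ⋃ j, ⋃ _ : j ≠ i, V j := by rw [← hOV']; exact hzO'
      exact hdis.le_bot ⟨h1, h2⟩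
    have hcov : connectedComponentIn A (x' : Euc (n+1)) ⊆ O ∪ O' := by
      intro z hz
      have hzS := hS z (hsub hz)
      obtain ⟨j, hj⟩ := mem_iUnion.1 (hmem ⟨z, hzS⟩ (hsub hz))
      by_cases hji : j = i
      · subst hji; rw [← hOV] at hj; exact Or.inl hj
      · have : (⟨z, hzS⟩ : Sph n) ∈ ⋃ j, ⋃ _ : j ≠ i, V j :=
          mem_iUnion.2 ⟨j, mem_iUnion.2 ⟨hji, hj⟩⟩
        rw [← hOV'] at this
        exact Or.inr this
    rcases isPreconnected_iff_subset_of_disjoint.1 hpre O O' hO hO' hcov hboth with hc | hc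
    · intro z hz
      have hzS := hS z (hsub hz)
      refine ⟨⟨z, hzS⟩, ?_, rfl⟩
      rw [← hOV]; exact hc hz
    · exfalso
      have h1 := hc (mem_connectedComponentIn hx)
      have h2 : x' ∈ ⋃ j, ⋃ _ : j ≠ i, V j := by rw [← hOV']; exact h1
      exact hdis.le_bot ⟨hi, h2⟩
  · apply ((hVc i).image _ continuous_subtype_val.continuousOn).subset_connectedComponentIn
    · exact mem_image_of_mem _ hi
    · rw [hA]; exact image_mono (subset_iUnion V i)

end

/-- **Lemma (Cannon).** For `n ≥ 3`, every `(n-1)`-dimensional Sierpiński space `X ⊆ S^n`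
admits a topological embedding `h : X → S^n` such that the frontier (in `S^n`) of every
connected component of `S^n \ h(X)` is a flat `(n-1)`-sphere. -/
theorem exists_embedding_flat_boundaries (n : ℕ) (hn : 3 ≤ n)
    (X : Set (Euc (n+1))) (hX : IsSierpinski n X) :
    ∃ h : ↥X → ↥(Sph n),
      Continuous h ∧ Function.Injective h ∧
      ∀ V ∈ compsOf ((Sph n) \ (Subtype.val '' Set.range h)),
        IsFlatSphere n (sphFrontier n V) := by
  haveI : Nontrivial (Euc n) := by
    haveI : Nonempty (Fin n) := ⟨⟨0, by omega⟩⟩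
    infer_instance
  obtain ⟨U, hUinj, hUmem, hUall, hUcell, hUdis, -, hUdiam⟩ := hX.exists_enum
  have hUsub : ∀ i, U i ⊆ Sph n \ X := by
    intro i
    obtain ⟨x, hx, hxe⟩ := hUmem i
    rw [hxe]
    exact connectedComponentIn_subset _ _
  have hch : ∀ i, ∃ e : Euc n → Sph n, EmbB e ∧
      e '' closedBall 0 1 = {y : Sph n | (y : Euc (n+1)) ∈ Sph n \ U i} :=
    fun i => cell_emb Set.sdiff_subset (hUcell i)
  choose e he heU using hch
  have hcapU : ∀ i, Subtype.val '' capA e i ⊆ closure (U i) := by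
    intro i
    have h1 := cap_sub_closure (he i)
    refine (image_mono h1).trans ((image_closure_subset_closure_image
      continuous_subtype_val).trans (closure_mono ?_))
    rintro _ ⟨y, hy, rfl⟩
    rw [heU i] at hy
    by_contra hyU
    exact hy ⟨y.2, hyU⟩
  have hsys : Sys e := by
    refine ⟨he, ?_, ?_⟩
    · intro i j hij
      rw [Set.disjoint_left]
      intro y hyi hyj
      have : (y : Euc (n+1)) ∈ closure (U i) ∩ closure (U j) :=
        ⟨hcapU i ⟨y, hyi, rfl⟩, hcapU j ⟨y, hyj, rfl⟩⟩
      rw [hUdis i j hij] at this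
      exact this
    · intro δ hδ
      have hev : ∀ᶠ i in atTop, Metric.diam (U i) < δ := hUdiam.eventually (gt_mem_nhds hδ)
      obtain ⟨N, hN⟩ := eventually_atTop.1 hev
      refine (Set.finite_lt_nat N).subset ?_
      intro i hi
      by_contra hiN
      have hiN' : N ≤ i := not_lt.1 hiN
      have hbd : Bornology.IsBounded (U i) :=
        isBounded_sphere.subset ((hUsub i).trans Set.sdiff_subset)
      have h1 : diam (capA e i) ≤ diam (U i) := by
        rw [← isometry_subtype_coe.diam_image (capA e i), ← diam_closure (U i)]
        exact diam_mono (hcapU i) hbd.closure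
      have h2 : δ ≤ diam (capA e i) := hi
      linarith [hN i hiN']
  obtain ⟨g, E, hgc, hgi, hE, hEd, hgE⟩ := iterate_all hsys
  have hXeq : {y : Sph n | ∀ i, y ∈ e i '' closedBall 0 1} =
      {y : Sph n | (y : Euc (n+1)) ∈ X} := by
    ext y
    constructor
    · intro hy
      by_contra hyX
      have hyA : (y : Euc (n+1)) ∈ Sph n \ X := ⟨y.2, hyX⟩
      obtain ⟨i, hi⟩ := hUall _ ⟨y, hyA, rfl⟩
      have h1 := hy i
      rw [heU i] at h1
      exact h1.2 (hi ▸ mem_connectedComponentIn hyA)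
    · intro hy i
      rw [heU i]
      exact ⟨y.2, fun hyU => (hUsub i hyU).2 hy⟩
  rw [hXeq] at hgc hgi hgE
  let ι : X → Sph n := fun x => ⟨x, hX.subset x.2⟩
  have hι : Continuous ι := Continuous.subtype_mk continuous_subtype_val _
  have hιm : ∀ x, ι x ∈ {y : Sph n | (y : Euc (n+1)) ∈ X} := fun x => x.2
  have hrange : Set.range (fun x => g (ι x)) = (⋃ i, E i '' ball 0 (1/2))ᶜ := by
    rw [← hgE]
    ext z
    constructor
    · rintro ⟨x, rfl⟩; exact ⟨ι x, hιm x, rfl⟩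
    · rintro ⟨y, hy, rfl⟩; exact ⟨⟨y, hy⟩, rfl⟩
  refine ⟨fun x => g (ι x), hgc.comp_continuous hι hιm, ?_, ?_⟩
  · intro x y hxy
    have h1 := hgi (hιm x) (hιm y) hxy
    exact Subtype.ext (congrArg (fun z : Sph n => (z : Euc (n+1))) h1)
  · intro V hV
    have hA : (Sph n) \ (Subtype.val '' Set.range (fun x => g (ι x))) =
        Subtype.val '' ⋃ i, E i '' ball 0 (1/2) := by
      rw [hrange]
      ext z
      constructor
      · rintro ⟨hz, hz'⟩
        refine ⟨⟨z, hz⟩, ?_, rfl⟩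
        by_contra hcon
        exact hz' ⟨⟨z, hz⟩, hcon, rfl⟩
      · rintro ⟨y, hy, rfl⟩
        refine ⟨y.2, ?_⟩
        rintro ⟨w, hw, hwy⟩
        rw [Subtype.ext hwy] at hw
        exact hw hy
    obtain ⟨i, rfl⟩ := comp_eq (fun i => E i '' ball 0 (1/2))
      (fun i => e_ball_open (hE i) (by norm_num))
      (fun i => (convex_ball (0 : Euc n) (1/2)).isPreconnected.image _
        ((hE i).cont.mono ((ball_subset_ball (by norm_num)).trans ball_subset_closedBall)))
      hEd hA hV
    have hset : ∀ S : Set (Sph n), {x : Sph n | (x : Euc (n+1)) ∈ Subtype.val '' S} = S := by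
      intro S
      ext x
      constructor
      · rintro ⟨y, hy, hyx⟩; rwa [← Subtype.ext hyx]
      · intro hx; exact ⟨x, hx, rfl⟩
    refine ⟨?_, ?_⟩
    · rintro _ ⟨y, -, rfl⟩; exact y.2
    · unfold sphFrontier
      rw [hset, hset, frontier_half (hE i)]
      exact flat_of_emb (hE i) (1/2) (by norm_num) (by norm_num)
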